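/- arXiv:math/0212165 — 3 statements merged into one kernel-verified Lean document; each statement's English description precedes it below -/
import Mathlib

section
/- For G the Cayley graph of the free product of a group of order s₁ and a group of order s₂ (s₁,s₂ ≥ 2, s₁+s₂ ≥ 5) with respect to all nonidentity elements, the tree entropy equals h(G) = (1 - 1/s₁)log(s₁-1) + (1 - 1/s₂)log(s₂-1) + (1 - 1/s₁ - 1/s₂)·log((s₁+s₂)/(s₁s₂ - s₁ - s₂)). -/
/-- The generating set of the free product `(ℤ/s₁) * (ℤ/s₂)`: all nonidentity elements of the
two factors. The corresponding Cayley graph is the free product `K_{s₁} * K_{s₂}` of complete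
graphs. -/
def fpGens (s₁ s₂ : ℕ) :
    Set (Monoid.Coprod (Multiplicative (ZMod s₁)) (Multiplicative (ZMod s₂))) :=
  {g | (∃ x : Multiplicative (ZMod s₁), x ≠ 1 ∧ g = Monoid.Coprod.inl x) ∨
       (∃ y : Multiplicative (ZMod s₂), y ≠ 1 ∧ g = Monoid.Coprod.inr y)}

/-- The `k`-step return probability of simple random walk on the Cayley graph of
`(ℤ/s₁) * (ℤ/s₂)` with respect to all nonidentity elements of the factors: the number of
words of length `k` in the generators with product the identity, divided by `(s₁+s₂-2)^k`. -/
noncomputable def fpRetProb (s₁ s₂ k : ℕ) : ℝ :=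
  (Nat.card {w : Fin k → fpGens s₁ s₂ //
      (List.ofFn fun i =>
        ((w i : Monoid.Coprod (Multiplicative (ZMod s₁)) (Multiplicative (ZMod s₂))))).prod
        = 1} : ℝ) / ((s₁ : ℝ) + s₂ - 2) ^ k

/-- The linear coefficient of the quadratic equation satisfied by the product of the
two first-passage generating functions. -/
noncomputable def passageCoeff (a b z : ℝ) : ℝ :=
  (1 - (a - 1) * z) * (1 - (b - 1) * z) - (a + b) * z ^ 2

/-- The product of the first-passage generating functions of the two factors `K_{a+1}`, `K_{b+1}`,
as the smaller root of `a b z² p² - M p + z² = 0`, where `M = passageCoeff a b z`. -/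
noncomputable def passageProd (a b z : ℝ) : ℝ :=
  2 * z ^ 2 /
    (passageCoeff a b z + Real.sqrt (passageCoeff a b z ^ 2 - 4 * (a * b) * z ^ 4))

/-- The first-passage generating function between distinct vertices of a copy of `K_{a+1}` in
the free product `K_{a+1} * K_{b+1}`. -/
noncomputable def passage (a b z : ℝ) : ℝ :=
  z * (1 + b * passageProd a b z) / (1 - (a - 1) * z)

/-- The closed form of the logarithmic generating function of closed walks. -/
noncomputable def logWalkGen (a b z : ℝ) : ℝ :=
  -Real.log (1 - z * (a * passage a b z + b * passage b a z)) +
    (a / (a + 1) * Real.log (1 - passage a b z) +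
      1 / (a + 1) * Real.log (1 + a * passage a b z)) +
    (b / (b + 1) * Real.log (1 - passage b a z) +
      1 / (b + 1) * Real.log (1 + b * passage b a z))

theorem passageCoeff_comm (a b z : ℝ) : passageCoeff b a z = passageCoeff a b z := by
  unfold passageCoeff; ring

theorem passageProd_comm (a b z : ℝ) : passageProd b a z = passageProd a b z := by
  unfold passageProd
  rw [passageCoeff_comm, mul_comm b a]

section

variable {a b z : ℝ}

theorem le_passageCoeff (hz : 0 ≤ z) (hz' : z * (a + b) ≤ 1) :
    (a * b + 1) * z ^ 2 ≤ passageCoeff a b z := by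
  have : passageCoeff a b z = (a * b + 1) * z ^ 2 + (1 - z * (a + b)) * (1 + 2 * z) := by
    unfold passageCoeff; ring
  rw [this]
  nlinarith [mul_nonneg (sub_nonneg.2 hz') (by linarith : 0 ≤ 1 + 2 * z)]

theorem passageCoeff_pos (hab : 1 < a * b) (hz : 0 ≤ z) (hz' : z * (a + b) ≤ 1) :
    0 < passageCoeff a b z := by
  rcases hz.eq_or_lt with rfl | hz0
  · simp [passageCoeff]
  · exact lt_of_lt_of_le (by positivity) (le_passageCoeff hz hz')

theorem passageDisc_pos (hab : 1 < a * b) (hz : 0 ≤ z) (hz' : z * (a + b) ≤ 1) :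
    0 < passageCoeff a b z ^ 2 - 4 * (a * b) * z ^ 4 := by
  rcases hz.eq_or_lt with rfl | hz0
  · simp [passageCoeff]
  · have h := le_passageCoeff hz hz'
    have h2 : ((a * b + 1) * z ^ 2) ^ 2 ≤ passageCoeff a b z ^ 2 :=
      pow_le_pow_left₀ (by positivity) h 2
    have h3 : 0 < (a * b - 1) ^ 2 * z ^ 4 := by
      have : 0 < a * b - 1 := by linarith
      positivity
    nlinarith

theorem le_sqrt_passageDisc (hab : 1 < a * b) (hz : 0 ≤ z) (hz' : z * (a + b) ≤ 1) :
    (a * b - 1) * z ^ 2 ≤ Real.sqrt (passageCoeff a b z ^ 2 - 4 * (a * b) * z ^ 4) := by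
  apply Real.le_sqrt_of_sq_le
  have h2 : ((a * b + 1) * z ^ 2) ^ 2 ≤ passageCoeff a b z ^ 2 :=
    pow_le_pow_left₀ (by positivity) (le_passageCoeff hz hz') 2
  nlinarith

theorem passageProd_nonneg (hab : 1 < a * b) (hz : 0 ≤ z) (hz' : z * (a + b) ≤ 1) :
    0 ≤ passageProd a b z := by
  have := passageCoeff_pos hab hz hz'
  unfold passageProd
  positivity

theorem mul_passageProd_le_one (hab : 1 < a * b) (hz : 0 ≤ z) (hz' : z * (a + b) ≤ 1) :
    a * b * passageProd a b z ≤ 1 := by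
  have h0 := passageCoeff_pos hab hz hz'
  have h1 := le_passageCoeff hz hz'
  have h2 := le_sqrt_passageDisc hab hz hz'
  unfold passageProd
  rw [← mul_div_assoc, div_le_one (by positivity)]
  linarith

theorem passageProd_quadratic (hab : 1 < a * b) (hz : 0 ≤ z) (hz' : z * (a + b) ≤ 1) :
    a * b * z ^ 2 * passageProd a b z ^ 2 - passageCoeff a b z * passageProd a b z + z ^ 2 = 0 := by
  have h0 := passageCoeff_pos hab hz hz'
  have h1 := Real.sq_sqrt (passageDisc_pos hab hz hz').le
  unfold passageProd
  set R := Real.sqrt (passageCoeff a b z ^ 2 - 4 * (a * b) * z ^ 4)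
  have hR : 0 ≤ R := Real.sqrt_nonneg _
  have : passageCoeff a b z + R ≠ 0 := by positivity
  field_simp
  linear_combination z ^ 2 * h1

theorem one_sub_mul_pos (hb : 1 ≤ b) (hz : 0 ≤ z) (hz' : z * (a + b) ≤ 1) :
    0 < 1 - (a - 1) * z := by
  rcases hz.eq_or_lt with rfl | hz0
  · simp
  · nlinarith

theorem passage_mul_passage (ha : 1 ≤ a) (hb : 1 ≤ b) (hab : 1 < a * b) (hz : 0 ≤ z)
    (hz' : z * (a + b) ≤ 1) :
    passage a b z * passage b a z = passageProd a b z := by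
  have h1 := one_sub_mul_pos hb hz hz'
  have h2 := one_sub_mul_pos (a := b) ha hz (by linarith)
  have h3 := passageProd_quadratic hab hz hz'
  unfold passage
  rw [passageProd_comm a b, div_mul_div_comm, div_eq_iff (by positivity)]
  unfold passageCoeff at h3
  linear_combination h3

theorem passage_eq (ha : 1 ≤ a) (hb : 1 ≤ b) (hab : 1 < a * b) (hz : 0 ≤ z)
    (hz' : z * (a + b) ≤ 1) :
    passage a b z =
      z * (1 + (a - 1) * passage a b z + b * (passage a b z * passage b a z)) := by
  have h1 := one_sub_mul_pos hb hz hz'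
  rw [passage_mul_passage ha hb hab hz hz']
  have : passage a b z * (1 - (a - 1) * z) = z * (1 + b * passageProd a b z) := by
    unfold passage
    rw [div_mul_cancel₀ _ h1.ne']
  linear_combination this

theorem passage_nonneg (hb : 1 ≤ b) (hab : 1 < a * b) (hz : 0 ≤ z) (hz' : z * (a + b) ≤ 1) :
    0 ≤ passage a b z := by
  have h1 := one_sub_mul_pos hb hz hz'
  have h2 := passageProd_nonneg hab hz hz'
  unfold passage
  positivity

theorem passage_lt_one (ha : 1 ≤ a) (hb : 1 ≤ b) (hab : 1 < a * b) (hz : 0 ≤ z)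
    (hz' : z * (a + b) ≤ 1) : passage a b z < 1 := by
  have h1 := one_sub_mul_pos hb hz hz'
  have h2 := mul_passageProd_le_one hab hz hz'
  have h3 := passageProd_nonneg hab hz hz'
  unfold passage
  rw [div_lt_one h1]
  rcases hz.eq_or_lt with rfl | hz0
  · simp
  · have hp : b * passageProd a b z < b := by
      nlinarith
    nlinarith

theorem one_sub_mul_passage_pos (ha : 1 ≤ a) (hb : 1 ≤ b) (hab : 1 < a * b) (hz : 0 ≤ z)
    (hz' : z * (a + b) ≤ 1) : 0 < 1 - z * (a * passage a b z + b * passage b a z) := by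
  rcases hz.eq_or_lt with rfl | hz0
  · simp
  · have h1 := passage_lt_one ha hb hab hz hz'
    have h2 := passage_lt_one (a := b) (b := a) hb ha (by linarith) hz (by linarith)
    have : z * (a * passage a b z + b * passage b a z) < z * (a + b) := by
      gcongr
      · nlinarith
      · nlinarith
    linarith

theorem differentiableAt_passage (hb : 1 ≤ b) (hab : 1 < a * b) (hz : 0 ≤ z)
    (hz' : z * (a + b) ≤ 1) : DifferentiableAt ℝ (passage a b) z := by
  have h1 := one_sub_mul_pos hb hz hz'
  have h2 := passageCoeff_pos hab hz hz'
  have h3 := passageDisc_pos hab hz hz'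
  have hM : DifferentiableAt ℝ (passageCoeff a b) z := by
    unfold passageCoeff; fun_prop
  have hp : DifferentiableAt ℝ (passageProd a b) z := by
    unfold passageProd
    refine DifferentiableAt.div (by fun_prop) (hM.add (DifferentiableAt.sqrt (by fun_prop) h3.ne'))
      (by positivity)
  unfold passage
  exact DifferentiableAt.div (by fun_prop) (by fun_prop) h1.ne'

theorem passage_green_identity (ha : 1 ≤ a) (hb : 1 ≤ b) (hab : 1 < a * b) (hz : 0 ≤ z)
    (hz' : z * (a + b) ≤ 1) :
    z * ((1 - passage a b z) * (1 + a * passage a b z)) =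
      passage a b z * (1 - z * (a * passage a b z + b * passage b a z)) := by
  linear_combination -passage_eq ha hb hab hz hz'

theorem hasDerivAt_logWalkGen (ha : 1 ≤ a) (hb : 1 ≤ b) (hab : 1 < a * b) (hz : 0 ≤ z)
    (hz' : z * (a + b) ≤ 1) :
    HasDerivAt (logWalkGen a b)
      ((a * passage a b z + b * passage b a z) /
        (1 - z * (a * passage a b z + b * passage b a z))) z := by
  have hba : 1 < b * a := by linarith
  have hz'' : z * (b + a) ≤ 1 := by linarith
  have hf := (differentiableAt_passage hb hab hz hz').hasDerivAt
  have hg := (differentiableAt_passage ha hba hz hz'').hasDerivAt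
  have i1 := passage_green_identity ha hb hab hz hz'
  have i2 := passage_green_identity hb ha hba hz hz''
  have f0 := passage_nonneg hb hab hz hz'
  have g0 := passage_nonneg ha hba hz hz''
  have f1 := sub_pos.2 (passage_lt_one ha hb hab hz hz')
  have g1 := sub_pos.2 (passage_lt_one hb ha hba hz hz'')
  have hP := one_sub_mul_passage_pos ha hb hab hz hz'
  have hf2 : 0 < 1 + a * passage a b z := by positivity
  have hg2 : 0 < 1 + b * passage b a z := by positivity
  have key := ((((hasDerivAt_id z).mul ((hf.const_mul a).add (hg.const_mul b))).const_sub 1).log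
    hP.ne').neg.add ((((hf.const_sub 1).log f1.ne').const_mul (a / (a + 1))).add
      ((((hf.const_mul a).const_add 1).log hf2.ne').const_mul (1 / (a + 1)))) |>.add
    ((((hg.const_sub 1).log g1.ne').const_mul (b / (b + 1))).add
      ((((hg.const_mul b).const_add 1).log hg2.ne').const_mul (1 / (b + 1))))
  refine HasDerivAt.congr_deriv (f := logWalkGen a b) key ?_
  simp only [id, Pi.mul_apply, Pi.add_apply]
  generalize deriv (passage a b) z = f' at *
  generalize deriv (passage b a) z = g' at *
  rw [add_comm (b * passage b a z)] at i2
  set f := passage a b z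
  set g := passage b a z
  set Q := 1 - z * (a * f + b * g) with hQ
  have aux : ∀ c h h' : ℝ, 0 < c → 0 < 1 - h → 0 < 1 + c * h →
      z * ((1 - h) * (1 + c * h)) = h * Q →
      c / (c + 1) * (-h' / (1 - h)) + 1 / (c + 1) * (c * h' / (1 + c * h)) =
        -(z * c * h' / Q) := by
    intro c h h' hc h1 h2 h3
    have e1 : c / (c + 1) * (-h' / (1 - h)) + 1 / (c + 1) * (c * h' / (1 + c * h)) =
        -(c * h' * h / ((1 - h) * (1 + c * h))) := by
      field_simp; ring
    rw [e1, neg_inj, div_eq_div_iff (by positivity) hP.ne']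
    linear_combination -(c * h') * h3
  rw [aux a f f' (by linarith) f1 hf2 i1, aux b g g' (by linarith) g1 hg2 i2]
  field_simp
  ring

theorem logWalkGen_zero : logWalkGen a b 0 = 0 := by
  simp [logWalkGen, passage]

theorem passage_radius (ha : 1 ≤ a) (hb : 1 ≤ b) (hab : 1 < a * b) :
    passage a b (1 / (a + b)) = (a + 1) / (a * (b + 1)) := by
  have hM : passageCoeff a b (1 / (a + b)) = (a * b + 1) / (a + b) ^ 2 := by
    unfold passageCoeff
    field_simp
    ring
  have hR : Real.sqrt (passageCoeff a b (1 / (a + b)) ^ 2 - 4 * (a * b) * (1 / (a + b)) ^ 4) =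
      (a * b - 1) / (a + b) ^ 2 := by
    rw [hM, Real.sqrt_eq_iff_mul_self_eq]
    · field_simp; ring
    · rw [sub_nonneg]
      have : 0 ≤ (a * b - 1) ^ 2 / (a + b) ^ 4 := by positivity
      have e : ((a * b + 1) / (a + b) ^ 2) ^ 2 - 4 * (a * b) * (1 / (a + b)) ^ 4 =
        (a * b - 1) ^ 2 / (a + b) ^ 4 := by field_simp; ring
      linarith
    · have : 0 < a * b - 1 := by linarith
      positivity
  have hp : passageProd a b (1 / (a + b)) = 1 / (a * b) := by
    unfold passageProd
    rw [hR, hM]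
    field_simp
    ring
  unfold passage
  rw [hp]
  have : 0 < 1 - (a - 1) * (1 / (a + b)) :=
    one_sub_mul_pos hb (by positivity) (by field_simp; exact le_rfl)
  rw [div_eq_div_iff this.ne' (by positivity)]
  field_simp
  ring

end

open Filter Topology in
/-- If the generating function of a sequence `c` of closed walk counts is given on `(0, 1/(a+b))`
by the Green function expressed through the first-passage functions, then the logarithmic series
converges at the endpoint to `logWalkGen`. -/
theorem hasSum_logWalkGen {a b : ℝ} (ha : 1 ≤ a) (hb : 1 ≤ b) (hab : 1 < a * b) (c : ℕ → ℝ)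
    (c_nonneg : ∀ n, 0 ≤ c n) (c_le : ∀ n, c n ≤ (a + b) ^ n) (c_zero : c 0 = 1)
    (hG : ∀ z, 0 < z → z * (a + b) < 1 →
      HasSum (fun n => c n * z ^ n) (1 / (1 - z * (a * passage a b z + b * passage b a z)))) :
    HasSum (fun n : ℕ => c (n + 1) / (a + b) ^ (n + 1) / (n + 1)) (logWalkGen a b (1 / (a + b))) := by
  have hD : 0 < a + b := by linarith
  set F : ℝ → ℝ := fun z => ∑' n : ℕ, c (n + 1) / (n + 1) * z ^ (n + 1) with hF
  have bound : ∀ z r, |z| ≤ r → ∀ n : ℕ,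
      ‖c (n + 1) * z ^ n‖ ≤ (a + b) * (r * (a + b)) ^ n := by
    intro z r hr n
    rw [norm_mul, norm_pow, Real.norm_eq_abs, Real.norm_eq_abs, abs_of_nonneg (c_nonneg _)]
    calc c (n + 1) * |z| ^ n ≤ (a + b) ^ (n + 1) * r ^ n := by
          gcongr
          exact c_le _
      _ = _ := by rw [pow_succ, mul_pow]; ring
  have hF' : ∀ z, |z| * (a + b) < 1 → HasDerivAt F (∑' n : ℕ, c (n + 1) * z ^ n) z := by
    intro z hz
    obtain ⟨r, hr1, hr2⟩ := exists_between ((lt_div_iff₀ hD).2 hz)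
    have hr0 : 0 < r := (abs_nonneg z).trans_lt hr1
    rw [lt_div_iff₀ hD] at hr2
    refine hasDerivAt_tsum_of_isPreconnected (t := Set.Ioo (-r) r) (y₀ := 0)
      (g := fun n z => c (n + 1) / (n + 1) * z ^ (n + 1)) (g' := fun n z => c (n + 1) * z ^ n)
      (u := fun n => (a + b) * (r * (a + b)) ^ n) ?_ isOpen_Ioo isPreconnected_Ioo ?_ ?_ ?_ ?_ ?_
    · exact (summable_geometric_of_lt_one (by positivity) hr2).mul_left _
    · intro n y _
      refine ((hasDerivAt_pow (n + 1) y).const_mul (c (n + 1) / (n + 1))).congr_deriv ?_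
      have : (n : ℝ) + 1 ≠ 0 := by positivity
      rw [Nat.add_sub_cancel]
      push_cast
      field_simp
    · intro n y hy
      have := abs_lt.2 hy
      exact bound y r this.le n
    · simp [hr0]
    · simp [summable_zero]
    · exact abs_lt.1 hr1
  have hderiv : ∀ z, 0 < z → z * (a + b) < 1 →
      ∑' n : ℕ, c (n + 1) * z ^ n = (a * passage a b z + b * passage b a z) /
        (1 - z * (a * passage a b z + b * passage b a z)) := by
    intro z hz hz'
    have h1 := (hasSum_nat_add_iff' 1).2 (hG z hz hz')
    have hP := one_sub_mul_passage_pos ha hb hab hz.le hz'.le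
    have h2 := h1.mul_left z⁻¹
    have e : ∀ n : ℕ, z⁻¹ * (c (n + 1) * z ^ (n + 1)) = c (n + 1) * z ^ n := fun n => by
      rw [pow_succ]
      field_simp
    simp only [e] at h2
    rw [h2.tsum_eq, Finset.sum_range_one, c_zero]
    field_simp
    ring
  have hFL : ∀ z, 0 ≤ z → z * (a + b) < 1 → F z = logWalkGen a b z := by
    intro z hz hz'
    rcases hz.eq_or_lt with rfl | hz0
    · simp [hF, logWalkGen_zero]
    have hd : ∀ x ∈ Set.Icc 0 z, x * (a + b) < 1 := fun x hx =>
      (mul_le_mul_of_nonneg_right hx.2 hD.le).trans_lt hz'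
    have hcF : ∀ x ∈ Set.Icc 0 z, HasDerivAt (fun y => F y - logWalkGen a b y)
        ((∑' n : ℕ, c (n + 1) * x ^ n) - (a * passage a b x + b * passage b a x) /
        (1 - x * (a * passage a b x + b * passage b a x))) x := fun x hx =>
      (hF' x (by rw [abs_of_nonneg hx.1]; exact hd x hx)).sub
        (hasDerivAt_logWalkGen ha hb hab hx.1 (hd x hx).le)
    obtain ⟨x, hx, e⟩ := exists_hasDerivAt_eq_slope _ _ hz0
      (fun x hx => (hcF x hx).continuousAt.continuousWithinAt)
      (fun x hx => hcF x (Set.Ioo_subset_Icc_self hx))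
    rw [hderiv x hx.1 (hd x (Set.Ioo_subset_Icc_self hx)), sub_self, eq_comm,
      div_eq_zero_iff] at e
    have F0 : F 0 = 0 := by simp [hF]
    rw [F0, logWalkGen_zero] at e
    rcases e with e | e <;> linarith
  set L := logWalkGen a b (1 / (a + b))
  have hlim : Tendsto (fun x : ℝ => logWalkGen a b (x / (a + b))) (𝓝[<] 1) (𝓝 L) := by
    have h1 : ContinuousAt (logWalkGen a b) (1 / (a + b)) :=
      (hasDerivAt_logWalkGen ha hb hab (by positivity) (by field_simp; exact le_rfl)).continuousAt
    have h2 : Tendsto (fun x : ℝ => x / (a + b)) (𝓝 1) (𝓝 (1 / (a + b))) :=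
      (continuous_id.div_const _).tendsto 1
    exact (h1.tendsto.comp h2).mono_left nhdsWithin_le_nhds
  have hev : ∀ᶠ x : ℝ in 𝓝[<] 1, 0 < x ∧ x < 1 :=
    Ioo_mem_nhdsLT (by norm_num : (0 : ℝ) < 1)
  have hlt : ∀ x : ℝ, x < 1 → x / (a + b) * (a + b) < 1 := fun x hx => by
    rwa [div_mul_cancel₀ _ hD.ne']
  have hs : ∀ z, 0 < z → z * (a + b) < 1 →
      Summable fun n : ℕ => c (n + 1) / (n + 1) * z ^ (n + 1) := by
    intro z hz hz'
    refine Summable.of_nonneg_of_le (fun n => ?_) (fun n => ?_)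
      ((summable_nat_add_iff 1).2 (hG z hz hz').summable)
    · have := c_nonneg (n + 1)
      positivity
    · gcongr
      exact div_le_self (c_nonneg _) (by linarith [n.cast_nonneg (α := ℝ)])
  set t : ℕ → ℝ := fun n => c (n + 1) / (a + b) ^ (n + 1) / (n + 1) with ht
  have t_nonneg : ∀ n, 0 ≤ t n := fun n => by
    have := c_nonneg (n + 1)
    positivity
  have hterm : ∀ (x : ℝ) (n : ℕ),
      t n * x ^ (n + 1) = c (n + 1) / (n + 1) * (x / (a + b)) ^ (n + 1) := fun x n => by
    simp only [ht, div_pow]; ring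
  have hpart : ∀ N, ∑ n ∈ Finset.range N, t n ≤ L := by
    intro N
    have h1 : Tendsto (fun x : ℝ => ∑ n ∈ Finset.range N, t n * x ^ (n + 1)) (𝓝[<] 1)
        (𝓝 (∑ n ∈ Finset.range N, t n * 1 ^ (n + 1))) :=
      (Continuous.tendsto (by fun_prop) 1).mono_left nhdsWithin_le_nhds
    simp only [one_pow, mul_one] at h1
    refine le_of_tendsto_of_tendsto h1 hlim ?_
    filter_upwards [hev] with x hx
    rw [← hFL _ (div_nonneg hx.1.le hD.le) (hlt x hx.2)]
    simp only [hterm]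
    refine (hs _ (div_pos hx.1 hD) (hlt x hx.2)).sum_le_tsum _ fun n _ => ?_
    rw [← hterm]
    exact mul_nonneg (t_nonneg n) (pow_nonneg hx.1.le _)
  have hsum : Summable t := summable_of_sum_range_le t_nonneg hpart
  have habel := Real.tendsto_tsum_powerSeries_nhdsWithin_lt hsum.hasSum.tendsto_sum_nat
  have hx : Tendsto (fun x : ℝ => x) (𝓝[<] 1) (𝓝 1) := nhdsWithin_le_nhds
  have habel' := hx.mul habel
  rw [one_mul] at habel'
  have hL : Tendsto (fun x : ℝ => x * ∑' n, t n * x ^ n) (𝓝[<] 1) (𝓝 L) := by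
    refine hlim.congr' ?_
    filter_upwards [hev] with x hx
    rw [← hFL _ (div_nonneg hx.1.le hD.le) (hlt x hx.2), ← tsum_mul_left]
    refine tsum_congr fun n => ?_
    rw [← hterm]
    ring
  rw [← tendsto_nhds_unique habel' hL]
  exact hsum.hasSum

theorem logWalkGen_radius {a b : ℝ} (ha : 1 ≤ a) (hb : 1 ≤ b) (hab : 1 < a * b) :
    logWalkGen a b (1 / (a + b)) = Real.log (a + b) -
      ((1 - 1 / (a + 1)) * Real.log a + (1 - 1 / (b + 1)) * Real.log b +
        (1 - 1 / (a + 1) - 1 / (b + 1)) * Real.log ((a + 1 + (b + 1)) / (a * b - 1))) := by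
  have hE : 0 < a * b - 1 := by linarith
  have ha0 : 0 < a := by linarith
  have hb0 : 0 < b := by linarith
  have hba : passage b a (1 / (a + b)) = (b + 1) / (b * (a + 1)) := by
    rw [add_comm a b, passage_radius hb ha (by linarith)]
  have e0 : 1 - 1 / (a + b) * (a * ((a + 1) / (a * (b + 1))) + b * ((b + 1) / (b * (a + 1)))) =
      (a + 1 + (b + 1)) * (a * b - 1) / ((a + b) * ((a + 1) * (b + 1))) := by
    field_simp; ring
  have e1 : ∀ x y : ℝ, 0 < x → 0 < y →
      1 - (x + 1) / (x * (y + 1)) = (x * y - 1) / (x * (y + 1)) := by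
    intro x y hx hy
    field_simp; ring
  have e2 : ∀ x y : ℝ, 0 < x → 0 < y →
      1 + x * ((x + 1) / (x * (y + 1))) = (x + 1 + (y + 1)) / (y + 1) := by
    intro x y hx hy
    field_simp; ring
  unfold logWalkGen
  rw [passage_radius ha hb hab, hba, e0, e1 a b ha0 hb0, e1 b a hb0 ha0, e2 a b ha0 hb0,
    e2 b a hb0 ha0, mul_comm b a, add_comm (b + 1) (a + 1)]
  rw [Real.log_div (by positivity) (by positivity), Real.log_div (by positivity) (by positivity),
    Real.log_div (by positivity) (by positivity), Real.log_div (by positivity) (by positivity),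
    Real.log_div (by positivity) (by positivity), Real.log_div (by positivity) (by positivity),
    Real.log_mul (by positivity) (by positivity), Real.log_mul (by positivity) (by positivity),
    Real.log_mul (by positivity) (by positivity), Real.log_mul (by positivity) (by positivity),
    Real.log_mul (by positivity) (by positivity)]
  field_simp
  ring

/-- A bounded solution of the Green function equation `g = δ₁ + z A g` for the Cayley graph with
generators `S` sums the generating function of closed words. -/
theorem hasSum_closedWords {P : Type*} [Monoid P] [DecidableEq P] (S : Set P) [Fintype S]
    (g : P → ℝ) (C z : ℝ) (hg : ∀ x, |g x| ≤ C) (hz : 0 ≤ z) (hz' : z * Fintype.card S < 1)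
    (hgreen : ∀ x, g x = (if x = 1 then 1 else 0) + z * ∑ s : S, g (s * x)) :
    HasSum (fun n => (Nat.card {w : Fin n → S // (List.ofFn fun i => (w i : P)).prod = 1} : ℝ) *
      z ^ n) (g 1) := by
  have card_eq : ∀ n, (Nat.card {w : Fin n → S // (List.ofFn fun i => (w i : P)).prod = 1} : ℝ) =
      ∑ w : Fin n → S, if (List.ofFn fun i => (w i : P)).prod = 1 then 1 else 0 := by
    intro n
    rw [Nat.card_eq_fintype_card, Fintype.card_subtype, Finset.sum_boole]
  have step : ∀ (h : P → ℝ) (n : ℕ), ∑ w : Fin (n + 1) → S, h (List.ofFn fun i => (w i : P)).prod =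
      ∑ w : Fin n → S, ∑ s : S, h (s * (List.ofFn fun i => (w i : P)).prod) := by
    intro h n
    rw [← (Fin.consEquiv (fun _ : Fin (n + 1) => S)).sum_comp, Fintype.sum_prod_type,
      Finset.sum_comm]
    simp [Fin.consEquiv, List.ofFn_succ]
  have partial_sum : ∀ n, g 1 = ∑ k ∈ Finset.range n,
      (Nat.card {w : Fin k → S // (List.ofFn fun i => (w i : P)).prod = 1} : ℝ) * z ^ k +
      z ^ n * ∑ w : Fin n → S, g (List.ofFn fun i => (w i : P)).prod := by
    intro n
    induction n with
    | zero => simp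
    | succ n ih =>
      rw [Finset.sum_range_succ, step, ih, card_eq]
      have : ∑ w : Fin n → S, g (List.ofFn fun i => (w i : P)).prod =
          ∑ w : Fin n → S, ((if (List.ofFn fun i => (w i : P)).prod = 1 then 1 else 0) +
            z * ∑ s : S, g (s * (List.ofFn fun i => (w i : P)).prod)) :=
        Finset.sum_congr rfl fun w _ => hgreen _
      rw [this, Finset.sum_add_distrib, ← Finset.mul_sum]
      ring
  rw [hasSum_iff_tendsto_nat_of_nonneg (fun n => by positivity)]
  have herr : Filter.Tendsto
      (fun n => z ^ n * ∑ w : Fin n → S, g (List.ofFn fun i => (w i : P)).prod)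
      Filter.atTop (nhds 0) := by
    refine squeeze_zero_norm (a := fun n => (z * Fintype.card S) ^ n * C) (fun n => ?_) ?_
    · rw [norm_mul, Real.norm_of_nonneg (by positivity), mul_pow, mul_assoc]
      gcongr
      refine (norm_sum_le _ _).trans ((Finset.sum_le_sum fun w _ => hg _).trans ?_)
      simp
    · simpa using (tendsto_pow_atTop_nhds_zero_of_lt_one (by positivity) hz').mul_const C
  have := (tendsto_const_nhds (x := g 1)).sub herr
  rw [sub_zero] at this
  refine this.congr fun n => ?_
  rw [sub_eq_iff_eq_add]
  exact partial_sum n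

namespace Monoid.CoprodI.Word

variable {ι : Type*} {M : ι → Type*} [∀ i, Monoid (M i)]

/-- The multiplicative weight of a reduced word giving weight `f i` to each letter from `M i`. -/
def weight (f : ι → ℝ) (w : Word M) : ℝ :=
  (w.toList.map fun l => f l.1).prod

theorem weight_empty (f : ι → ℝ) : weight f (empty : Word M) = 1 := by
  simp [weight]

theorem abs_weight_le_one {f : ι → ℝ} (hf : ∀ i, |f i| ≤ 1) (w : Word M) :
    |weight f w| ≤ 1 := by
  unfold weight
  induction w.toList with
  | nil => simp
  | cons l t ih =>
    rw [List.map_cons, List.prod_cons, abs_mul]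
    exact mul_le_one₀ (hf _) (abs_nonneg _) ih

variable [∀ i, DecidableEq (M i)]

theorem weight_rcons (f : ι → ℝ) {i : ι} (p : Pair M i) :
    weight f (rcons p) = (if p.head = 1 then 1 else f i) * weight f p.tail := by
  unfold rcons
  split_ifs <;> simp [weight]

variable [DecidableEq ι]

theorem sum_weight_of_smul (f : ι → ℝ) {G : ι → Type*} [∀ i, Group (G i)]
    [∀ i, DecidableEq (G i)] (i : ι) [Fintype (G i)] (w : Word G) :
    ∑ m : G i, weight f (of m • w) =
      (1 + (Fintype.card (G i) - 1) * f i) * weight f (equivPair i w).tail := by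
  simp only [of_smul_def, weight_rcons, ← Finset.sum_mul]
  congr 1
  refine (Equiv.sum_comp (Equiv.mulRight (equivPair i w).head)
    (fun m => if m = 1 then (1 : ℝ) else f i)).trans ?_
  rw [← Finset.add_sum_erase _ _ (Finset.mem_univ 1), if_pos rfl,
    Finset.sum_congr rfl fun m hm => if_neg (Finset.ne_of_mem_erase hm)]
  simp [Finset.card_erase_of_mem, Nat.cast_sub Fintype.card_pos]

end Monoid.CoprodI.Word

section FreeProduct

open Monoid

variable (s₁ s₂ : ℕ)

/-- The two cyclic factors as a family indexed by `Bool`. -/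
abbrev CyclicFactor (i : Bool) : Type := Multiplicative (ZMod (cond i s₁ s₂))

/-- The binary free product mapped to the indexed free product. -/
def coprodToCoprodI : Monoid.Coprod (Multiplicative (ZMod s₁)) (Multiplicative (ZMod s₂)) →*
    CoprodI (CyclicFactor s₁ s₂) :=
  Coprod.lift (CoprodI.of (M := CyclicFactor s₁ s₂) (i := true))
    (CoprodI.of (M := CyclicFactor s₁ s₂) (i := false))

/-- The inclusions of the two factors into the binary free product. -/
def coprodFactor : (i : Bool) → CyclicFactor s₁ s₂ i →*
    Monoid.Coprod (Multiplicative (ZMod s₁)) (Multiplicative (ZMod s₂))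
  | true => Coprod.inl
  | false => Coprod.inr

/-- The inverse of `coprodToCoprodI`. -/
def coprodIToCoprod : CoprodI (CyclicFactor s₁ s₂) →*
    Monoid.Coprod (Multiplicative (ZMod s₁)) (Multiplicative (ZMod s₂)) :=
  CoprodI.lift (coprodFactor s₁ s₂)

theorem coprodToCoprodI_injective : Function.Injective (coprodToCoprodI s₁ s₂) := by
  have h : (coprodIToCoprod s₁ s₂).comp (coprodToCoprodI s₁ s₂) = MonoidHom.id _ := by
    apply Coprod.hom_ext
    · refine MonoidHom.ext fun x => ?_
      exact CoprodI.lift_of (M := CyclicFactor s₁ s₂) (coprodFactor s₁ s₂) (i := true) x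
    · refine MonoidHom.ext fun x => ?_
      exact CoprodI.lift_of (M := CyclicFactor s₁ s₂) (coprodFactor s₁ s₂) (i := false) x
  exact Function.LeftInverse.injective (DFunLike.congr_fun h)

/-- The generators are the disjoint union of the nonidentity elements of the factors. -/
noncomputable def fpGensEquiv :
    {x : Multiplicative (ZMod s₁) // x ≠ 1} ⊕ {y : Multiplicative (ZMod s₂) // y ≠ 1} ≃
      fpGens s₁ s₂ :=
  Equiv.ofBijective
    (Sum.elim (fun x => ⟨Coprod.inl x.1, Or.inl ⟨x.1, x.2, rfl⟩⟩)
      (fun y => ⟨Coprod.inr y.1, Or.inr ⟨y.1, y.2, rfl⟩⟩)) <| by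
    constructor
    · rintro (⟨x, hx⟩ | ⟨x, hx⟩) (⟨y, hy⟩ | ⟨y, hy⟩) h
      · simpa using Coprod.inl_injective (congrArg Subtype.val h)
      · have := congrArg Coprod.fst (congrArg Subtype.val h)
        simp [hx] at this
      · have := congrArg Coprod.fst (congrArg Subtype.val h)
        simp [hy.symm] at this
      · simpa using Coprod.inr_injective (congrArg Subtype.val h)
    · rintro ⟨_, ⟨x, hx, rfl⟩ | ⟨y, hy, rfl⟩⟩
      · exact ⟨Sum.inl ⟨x, hx⟩, rfl⟩
      · exact ⟨Sum.inr ⟨y, hy⟩, rfl⟩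

variable [NeZero s₁] [NeZero s₂]

noncomputable instance : Fintype (fpGens s₁ s₂) := Fintype.ofEquiv _ (fpGensEquiv s₁ s₂)

theorem sum_fpGens
    (h : Monoid.Coprod (Multiplicative (ZMod s₁)) (Multiplicative (ZMod s₂)) → ℝ) :
    ∑ s : fpGens s₁ s₂, h s =
      (∑ x : Multiplicative (ZMod s₁), h (Coprod.inl x) - h 1) +
        (∑ y : Multiplicative (ZMod s₂), h (Coprod.inr y) - h 1) := by
  have aux : ∀ {G : Type} [Group G] [Fintype G] [DecidableEq G] (k : G → ℝ),
      ∑ x : {x : G // x ≠ 1}, k x = ∑ x, k x - k 1 := by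
    intro G _ _ _ k
    rw [← Finset.sum_subtype (Finset.univ.erase 1) (by simp) k,
      ← Finset.sum_erase_add _ _ (Finset.mem_univ 1), add_sub_cancel_right]
  rw [← (fpGensEquiv s₁ s₂).sum_comp, Fintype.sum_sum_type]
  have h1 := aux fun x : Multiplicative (ZMod s₁) => h (Coprod.inl x)
  have h2 := aux fun x : Multiplicative (ZMod s₂) => h (Coprod.inr x)
  rw [map_one] at h1 h2
  rw [← h1, ← h2]
  rfl

theorem card_fpGens : (Fintype.card (fpGens s₁ s₂) : ℝ) = (s₁ - 1) + (s₂ - 1) := by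
  have := sum_fpGens s₁ s₂ fun _ => 1
  simpa using this

open CoprodI.Word in
/-- The Green function of simple random walk on the free product is a multiplicative weight on
reduced words. -/
theorem hasSum_closedWords_fpGens {f g z : ℝ} (hf : |f| ≤ 1) (hg : |g| ≤ 1) (hz : 0 ≤ z)
    (hz' : z * ((s₁ - 1) + (s₂ - 1)) < 1)
    (hP : 1 - z * ((s₁ - 1) * f + (s₂ - 1) * g) ≠ 0)
    (ef : f = z * (1 + ((s₁ - 1) - 1) * f + (s₂ - 1) * (f * g)))
    (eg : g = z * (1 + ((s₂ - 1) - 1) * g + (s₁ - 1) * (g * f))) :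
    HasSum (fun n => (Nat.card {w : Fin n → fpGens s₁ s₂ //
      (List.ofFn fun i =>
        ((w i : Monoid.Coprod (Multiplicative (ZMod s₁)) (Multiplicative (ZMod s₂))))).prod
        = 1} : ℝ) * z ^ n) (1 / (1 - z * ((s₁ - 1) * f + (s₂ - 1) * g))) := by
  classical
  set Γ := 1 / (1 - z * ((s₁ - 1) * f + (s₂ - 1) * g)) with hΓ
  have : ∀ i, NeZero (cond i s₁ s₂) := by rintro (_ | _) <;> assumption
  let φ : Bool → ℝ := fun i => cond i f g
  have hφ : ∀ i, |φ i| ≤ 1 := by rintro (_ | _) <;> assumption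
  let W : CoprodI.Word (CyclicFactor s₁ s₂) → ℝ := weight φ
  let V : Monoid.Coprod (Multiplicative (ZMod s₁)) (Multiplicative (ZMod s₂)) → ℝ :=
    fun x => Γ * W (coprodToCoprodI s₁ s₂ x • (empty : CoprodI.Word (CyclicFactor s₁ s₂)))
  have hV1 : V 1 = Γ := by
    simp [V, W, weight_empty]
  rw [← hV1]
  refine hasSum_closedWords (fpGens s₁ s₂) V |Γ| z ?_ hz (by rwa [card_fpGens]) ?_
  · intro x
    rw [abs_mul]
    exact mul_le_of_le_one_right (abs_nonneg _) (abs_weight_le_one hφ _)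
  intro x
  rw [sum_fpGens s₁ s₂ fun s => V (s * x)]
  set w := coprodToCoprodI s₁ s₂ x • (empty : CoprodI.Word (CyclicFactor s₁ s₂)) with hw
  have hwx : w = empty ↔ x = 1 := by
    rw [← map_eq_one_iff _ (coprodToCoprodI_injective s₁ s₂), ← CoprodI.Word.equiv.injective.eq_iff]
    have h1 : CoprodI.Word.equiv (1 : CoprodI (CyclicFactor s₁ s₂)) = empty :=
      one_smul (CoprodI (CyclicFactor s₁ s₂)) _
    rw [h1]
    rfl
  have hS1 : ∑ m : Multiplicative (ZMod s₁), V (Coprod.inl m * x) =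
      Γ * ((1 + (s₁ - 1) * f) * W (equivPair true w).tail) := by
    have := sum_weight_of_smul φ (G := CyclicFactor s₁ s₂) true w
    simp only [V, map_mul, mul_smul, ← Finset.mul_sum, ← hw]
    congr 1
    refine this.trans ?_
    simp [φ, W]
  have hS2 : ∑ m : Multiplicative (ZMod s₂), V (Coprod.inr m * x) =
      Γ * ((1 + (s₂ - 1) * g) * W (equivPair false w).tail) := by
    have := sum_weight_of_smul φ (G := CyclicFactor s₁ s₂) false w
    simp only [V, map_mul, mul_smul, ← Finset.mul_sum, ← hw]
    congr 1
    refine this.trans ?_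
    simp [φ, W]
  rw [hS1, hS2, one_mul]
  have hVx : V x = Γ * W w := rfl
  rw [hVx]
  clear_value w
  by_cases hx : x = 1
  · rw [if_pos hx, hwx.2 hx, equivPair_eq_of_fstIdx_ne (by simp [fstIdx]),
      equivPair_eq_of_fstIdx_ne (by simp [fstIdx])]
    have hW : W empty = 1 := weight_empty φ
    simp only [hW]
    have : Γ * (1 - z * ((s₁ - 1) * f + (s₂ - 1) * g)) = 1 := by
      rw [hΓ, one_div, inv_mul_cancel₀ hP]
    linear_combination this
  · rw [if_neg hx]
    have hne : w ≠ empty := fun h => hx (hwx.1 h)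
    clear hVx hS1 hS2 hwx hw
    induction w using consRecOn with
    | empty => exact absurd rfl hne
    | cons i m w h1 h2 _ =>
      have hc : cons m w h1 h2 = rcons ⟨m, w, h1⟩ := by simp [rcons, h2]
      have hWc : W (cons m w h1 h2) = φ i * W w := by
        simp [W, weight]
      have hi : equivPair i (cons m w h1 h2) = ⟨m, w, h1⟩ := by
        rw [hc, ← equivPair_symm, Equiv.apply_symm_apply]
      have hj : ∀ j, i ≠ j → (equivPair j (cons m w h1 h2)).tail = cons m w h1 h2 := by
        intro j hij
        rw [equivPair_eq_of_fstIdx_ne (by simpa using hij)]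
      cases i with
      | true =>
        rw [hi, hj false (by simp), hWc]
        simp only [φ, cond]
        linear_combination Γ * W w * ef
      | false =>
        rw [hi, hj true (by simp), hWc]
        simp only [φ, cond]
        linear_combination Γ * W w * eg

end FreeProduct

/-- Proposition: for the Cayley graph `G = K_{s₁} * K_{s₂}` of the free product of groups of
orders `s₁, s₂` (with `s₁, s₂ ≥ 2`, `s₁ + s₂ ≥ 5`), with respect to all nonidentity elements,
the tree entropy `h(G) = log(s₁+s₂-2) - ∑_{k≥1} p_k(o;G)/k` equals
`(1-1/s₁)log(s₁-1) + (1-1/s₂)log(s₂-1) + (1-1/s₁-1/s₂)log((s₁+s₂)/(s₁s₂-s₁-s₂))`. -/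
theorem stmt12 (s₁ s₂ : ℕ) (h₁ : 2 ≤ s₁) (h₂ : 2 ≤ s₂) (h₅ : 5 ≤ s₁ + s₂) :
    Real.log ((s₁ : ℝ) + s₂ - 2) - ∑' k : ℕ, fpRetProb s₁ s₂ (k + 1) / (k + 1) =
      (1 - 1 / (s₁ : ℝ)) * Real.log ((s₁ : ℝ) - 1) +
        (1 - 1 / (s₂ : ℝ)) * Real.log ((s₂ : ℝ) - 1) +
        (1 - 1 / (s₁ : ℝ) - 1 / (s₂ : ℝ)) *
          Real.log (((s₁ : ℝ) + s₂) / ((s₁ : ℝ) * s₂ - s₁ - s₂)) := by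
  have : NeZero s₁ := ⟨by lia⟩
  have : NeZero s₂ := ⟨by lia⟩
  have r₁ : (2 : ℝ) ≤ s₁ := by exact_mod_cast h₁
  have r₂ : (2 : ℝ) ≤ s₂ := by exact_mod_cast h₂
  have r₅ : (5 : ℝ) ≤ s₁ + s₂ := by exact_mod_cast h₅
  obtain ⟨a, ha⟩ : ∃ a : ℝ, a = s₁ - 1 := ⟨_, rfl⟩
  obtain ⟨b, hb⟩ : ∃ b : ℝ, b = s₂ - 1 := ⟨_, rfl⟩
  have ha1 : 1 ≤ a := by linarith
  have hb1 : 1 ≤ b := by linarith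
  have hab : 1 < a * b := by nlinarith
  have hba : 1 < b * a := by linarith
  have hcard : (Fintype.card (fpGens s₁ s₂) : ℝ) = a + b := by rw [card_fpGens, ha, hb]
  have key := hasSum_logWalkGen ha1 hb1 hab
    (fun n => (Nat.card {w : Fin n → fpGens s₁ s₂ //
      (List.ofFn fun i =>
        ((w i : Monoid.Coprod (Multiplicative (ZMod s₁)) (Multiplicative (ZMod s₂))))).prod
        = 1} : ℝ)) (fun n => by positivity) (fun n => ?_) (by simp) ?_
  · have hD : (s₁ : ℝ) + s₂ - 2 = a + b := by rw [ha, hb]; ring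
    have hsum : ∑' k : ℕ, fpRetProb s₁ s₂ (k + 1) / (k + 1) = logWalkGen a b (1 / (a + b)) := by
      rw [← key.tsum_eq]
      simp only [fpRetProb, hD]
    have hs₁ : (s₁ : ℝ) = a + 1 := by linarith
    have hs₂ : (s₂ : ℝ) = b + 1 := by linarith
    have hE : (a + 1) * (b + 1) - (a + 1) - (b + 1) = a * b - 1 := by ring
    rw [hsum, logWalkGen_radius ha1 hb1 hab, hD, hs₁, hs₂, hE, add_sub_cancel_right,
      add_sub_cancel_right, sub_sub_cancel]
  · rw [← hcard]
    have := Finite.card_subtype_le fun w : Fin n → fpGens s₁ s₂ => (List.ofFn fun i =>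
        ((w i : Monoid.Coprod (Multiplicative (ZMod s₁)) (Multiplicative (ZMod s₂))))).prod = 1
    rw [Nat.card_fun, Nat.card_fin, Nat.card_eq_fintype_card (α := fpGens s₁ s₂)] at this
    exact_mod_cast this
  · intro z hz hz'
    have hz'' : z * (b + a) < 1 := by linarith
    have f0 := passage_nonneg hb1 hab hz.le hz'.le
    have g0 := passage_nonneg ha1 hba hz.le hz''.le
    have f1 := passage_lt_one ha1 hb1 hab hz.le hz'.le
    have g1 := passage_lt_one hb1 ha1 hba hz.le hz''.le
    have hP := one_sub_mul_passage_pos ha1 hb1 hab hz.le hz'.le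
    have ef := passage_eq ha1 hb1 hab hz.le hz'.le
    have eg := passage_eq hb1 ha1 hba hz.le hz''.le
    have := hasSum_closedWords_fpGens s₁ s₂ (f := passage a b z) (g := passage b a z) (z := z)
    rw [← ha, ← hb] at this
    exact this (abs_le.2 ⟨by linarith, f1.le⟩) (abs_le.2 ⟨by linarith, g1.le⟩) hz.le hz' hP.ne' ef eg
end

section
/- The tree entropy of the hypercubic lattice ℤ^d is given by h(ℤ^d) = ∫_{[0,1]^d} log(2d - 2∑_{i=1}^d cos(2πs_i)) ds. In particular, for d = 2, h(ℤ²) = ∫₀¹∫₀¹ log(4 - 2cos 2πx - 2cos 2πy) dx dy = 4C/π, where C = ∑_{k≥0} (-1)^k/(2k+1)² is Catalan's constant. -/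
open scoped Real

/-- The set of the `2d` unit steps `±e_i` of the nearest-neighbor lattice `ℤ^d`. -/
def latticeSteps (d : ℕ) : Set (Fin d → ℤ) :=
  {v | ∃ (i : Fin d), (v = fun j => if j = i then 1 else 0) ∨
       (v = fun j => if j = i then -1 else 0)}

/-- The `k`-step return probability of simple random walk on `ℤ^d`: the number of length-`k`
sequences of unit steps summing to `0`, divided by `(2d)^k`. -/
noncomputable def latticeRetProb (d k : ℕ) : ℝ :=
  (Nat.card {w : Fin k → latticeSteps d //
      (∑ i : Fin k, ((w i : Fin d → ℤ))) = 0} : ℝ) / (2 * d) ^ k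

/-- The tree entropy of `ℤ^d`: `log(2d) - ∑_{k≥1} p_k(0;ℤ^d)/k`. -/
noncomputable def latticeTreeEntropy (d : ℕ) : ℝ :=
  Real.log (2 * d) - ∑' k : ℕ, latticeRetProb d (k + 1) / (k + 1)

open MeasureTheory

theorem sum_latticeSteps {d : ℕ} [Fintype (latticeSteps d)] {M : Type*} [AddCommMonoid M]
    (f : (Fin d → ℤ) → M) :
    ∑ v : latticeSteps d, f v = ∑ i : Fin d, (f (Pi.single i 1) + f (Pi.single i (-1))) := by
  classical
  have hs (i : Fin d) (c : ℤ) : (fun j => if j = i then c else 0) = Pi.single i c := by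
    ext j; simp [Pi.single_apply]
  let g : Fin d × Bool → latticeSteps d := fun p =>
    ⟨Pi.single p.1 (if p.2 then 1 else -1), p.1, by
      rcases p with ⟨i, _ | _⟩ <;> simp [hs]⟩
  have hg : Function.Bijective g := by
    constructor
    · rintro ⟨i, b⟩ ⟨j, c⟩ h
      have h' : (Pi.single i (if b then 1 else -1) : Fin d → ℤ) =
          Pi.single j (if c then 1 else -1) :=
        congrArg Subtype.val h
      have hij : i = j := by
        by_contra hne
        have := congrFun h' i
        rw [Pi.single_eq_same, Pi.single_eq_of_ne hne] at this
        cases b <;> simp at this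
      subst hij
      have := Pi.single_injective i h'
      cases b <;> cases c <;> simp at this ⊢
    · rintro ⟨v, i, h | h⟩
      · exact ⟨(i, true), Subtype.ext (by simp [g, h, hs])⟩
      · exact ⟨(i, false), Subtype.ext (by simp [g, h, hs])⟩
  rw [← hg.sum_comp (fun v => f v.1), Fintype.sum_prod_type]
  simp [g]

instance latticeSteps.instFinite (d : ℕ) : Finite (latticeSteps d) := by
  refine Set.Finite.subset (Set.finite_iUnion fun i : Fin d =>
    Set.toFinite {(fun j => if j = i then 1 else 0 : Fin d → ℤ), fun j => if j = i then -1 else 0}) ?_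
  rintro v ⟨i, h⟩
  exact Set.mem_iUnion.2 ⟨i, h⟩

/-- The uniform probability measure on the unit cube `[0,1]^d`. -/
noncomputable def cubeMeasure (d : ℕ) : Measure (Fin d → ℝ) :=
  Measure.pi fun _ => volume.restrict (Set.Icc (0 : ℝ) 1)

instance isProbabilityMeasure_restrict_Icc_zero_one :
    IsProbabilityMeasure (volume.restrict (Set.Icc (0 : ℝ) 1)) :=
  ⟨by simp⟩

instance cubeMeasure.instIsProbabilityMeasure (d : ℕ) : IsProbabilityMeasure (cubeMeasure d) := by
  unfold cubeMeasure; infer_instance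

theorem volume_restrict_cube (d : ℕ) :
    volume.restrict (Set.univ.pi fun _ : Fin d => Set.Icc (0 : ℝ) 1) = cubeMeasure d := by
  rw [cubeMeasure, volume_pi, Measure.restrict_pi_pi]

/-- The character `s ↦ exp(2πi n·s)` of the torus, with frequency `n ∈ ℤ^d`. -/
noncomputable def cubeChar {d : ℕ} (n : Fin d → ℤ) (s : Fin d → ℝ) : ℂ :=
  ∏ i, Complex.exp (2 * π * Complex.I * n i * s i)

theorem continuous_cubeChar {d : ℕ} (n : Fin d → ℤ) : Continuous (cubeChar n) := by
  unfold cubeChar; fun_prop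

theorem cubeChar_sum {d : ℕ} {ι : Type*} (t : Finset ι) (w : ι → Fin d → ℤ) (s : Fin d → ℝ) :
    cubeChar (∑ j ∈ t, w j) s = ∏ j ∈ t, cubeChar (w j) s := by
  simp only [cubeChar]
  rw [Finset.prod_comm]
  refine Finset.prod_congr rfl fun i _ => ?_
  rw [← Complex.exp_sum]
  congr 1
  rw [Finset.sum_apply, Int.cast_sum, Finset.mul_sum, Finset.sum_mul]

theorem cubeChar_single {d : ℕ} (i : Fin d) (c : ℤ) (s : Fin d → ℝ) :
    cubeChar (Pi.single i c) s = Complex.exp (2 * π * Complex.I * c * s i) := by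
  rw [cubeChar, Finset.prod_eq_single i]
  · simp
  · intro j _ hj; simp [hj]
  · simp

theorem integral_exp_two_pi_int (n : ℤ) :
    ∫ t in Set.Icc (0 : ℝ) 1, Complex.exp (2 * π * Complex.I * n * t) = if n = 0 then 1 else 0 := by
  split_ifs with h
  · simp [h]
  · have hc : 2 * π * Complex.I * n ≠ 0 := by
      simp [h, Real.pi_ne_zero]
    rw [integral_Icc_eq_integral_Ioc, ← intervalIntegral.integral_of_le zero_le_one,
      integral_exp_mul_complex hc]
    have : Complex.exp (2 * π * Complex.I * n) = 1 := by
      rw [mul_comm, Complex.exp_int_mul_two_pi_mul_I]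
    simp [this]

theorem integral_cubeChar {d : ℕ} (n : Fin d → ℤ) :
    ∫ s, cubeChar n s ∂cubeMeasure d = if n = 0 then 1 else 0 := by
  simp only [cubeChar, cubeMeasure]
  rw [integral_fintype_prod_eq_prod
    (f := fun i (t : ℝ) => Complex.exp (2 * π * Complex.I * n i * t))]
  simp only [integral_exp_two_pi_int]
  rw [Finset.prod_ite_zero]
  simp [funext_iff]

theorem sum_cubeChar_latticeSteps {d : ℕ} [Fintype (latticeSteps d)] (s : Fin d → ℝ) :
    ∑ v : latticeSteps d, cubeChar v.1 s = (2 * ∑ i, Real.cos (2 * π * s i) : ℝ) := by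
  rw [sum_latticeSteps (fun v => cubeChar v s)]
  push_cast
  rw [Finset.mul_sum]
  refine Finset.sum_congr rfl fun i _ => ?_
  rw [cubeChar_single, cubeChar_single, Complex.two_cos]
  congr 2 <;> push_cast <;> ring

theorem card_latticeSteps_closed (d k : ℕ) :
    (Nat.card {w : Fin k → latticeSteps d // (∑ i : Fin k, ((w i : Fin d → ℤ))) = 0} : ℝ) =
      ∫ s, (2 * ∑ i, Real.cos (2 * π * s i)) ^ k ∂cubeMeasure d := by
  classical
  have := Fintype.ofFinite (latticeSteps d)
  rw [← Complex.ofReal_inj, ← integral_complex_ofReal]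
  simp only [Complex.ofReal_pow, ← sum_cubeChar_latticeSteps, Fintype.sum_pow, ← cubeChar_sum]
  rw [integral_finsetSum]
  · simp only [integral_cubeChar]
    rw [Nat.card_eq_fintype_card, Fintype.card_subtype]
    simp
  · intro w _
    have hc := continuous_cubeChar (∑ i, (w i : Fin d → ℤ))
    refine Integrable.of_bound hc.aestronglyMeasurable 1 (Filter.Eventually.of_forall fun s => ?_)
    rw [cubeChar, norm_prod]
    refine (Finset.prod_eq_one fun i _ => ?_).le
    rw [Complex.norm_exp]
    simp

theorem latticeRetProb_eq_integral (d k : ℕ) :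
    latticeRetProb d k =
      ∫ s, ((2 * ∑ i, Real.cos (2 * π * s i)) / (2 * d)) ^ k ∂cubeMeasure d := by
  simp only [latticeRetProb, card_latticeSteps_closed, div_pow, integral_div]

theorem hasSum_integral_pow_div {α : Type*} [MeasurableSpace α] {μ : Measure α} {φ : α → ℝ}
    (hφ : Measurable φ) (h1 : ∀ᵐ a ∂μ, |φ a| < 1)
    (hint : Integrable (fun a => Real.log (1 - |φ a|)) μ) :
    Integrable (fun a => Real.log (1 - φ a)) μ ∧
      HasSum (fun k : ℕ => ∫ a, φ a ^ (k + 1) / (k + 1) ∂μ) (-∫ a, Real.log (1 - φ a) ∂μ) := by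
  have hsum : ∀ᵐ a ∂μ, HasSum (fun k : ℕ => |φ a| ^ (k + 1) / (k + 1)) (-Real.log (1 - |φ a|)) := by
    filter_upwards [h1] with a ha
    exact Real.hasSum_pow_div_log_of_abs_lt_one (by rwa [abs_abs])
  have hnorm (k : ℕ) (a : α) : ‖φ a ^ (k + 1) / ((k : ℝ) + 1)‖ = |φ a| ^ (k + 1) / (k + 1) := by
    rw [norm_div, norm_pow, Real.norm_eq_abs, Real.norm_of_nonneg (by positivity)]
  constructor
  · refine Integrable.mono' hint.neg (hφ.const_sub 1).log.aestronglyMeasurable ?_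
    filter_upwards [h1, hsum] with a ha hs
    rw [← norm_neg]
    exact (Real.hasSum_pow_div_log_of_abs_lt_one ha).norm_le_of_bounded hs fun k => (hnorm k a).le
  · rw [← integral_neg]
    refine hasSum_integral_of_dominated_convergence
      (fun (k : ℕ) a => |φ a| ^ (k + 1) / (k + 1)) (fun k => by fun_prop)
      (fun k => Filter.Eventually.of_forall fun a => (hnorm k a).le)
      (hsum.mono fun a h => h.summable) ?_ ?_
    · exact hint.neg.congr (hsum.mono fun a h => h.tsum_eq.symm)
    · filter_upwards [h1] with a ha
      exact Real.hasSum_pow_div_log_of_abs_lt_one ha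

theorem integrable_log_abs_sin_two_pi :
    Integrable (fun t => Real.log |Real.sin (2 * π * t)|)
      (volume.restrict (Set.Icc (0 : ℝ) 1)) := by
  have h : IntervalIntegrable (Real.log ∘ Real.sin) volume 0 (2 * π) := intervalIntegrable_log_sin
  have h2 := h.comp_mul_left (c := 2 * π)
  rw [zero_div, div_self (by positivity), intervalIntegrable_iff_integrableOn_Icc_of_le zero_le_one]
    at h2
  simpa [IntegrableOn, Function.comp_def] using h2

theorem ae_sin_two_pi_ne_zero :
    ∀ᵐ t ∂(volume.restrict (Set.Icc (0 : ℝ) 1)), Real.sin (2 * π * t) ≠ 0 := by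
  refine ae_restrict_of_ae ?_
  have hc : Set.Countable {t : ℝ | Real.sin (2 * π * t) = 0} := by
    refine (Set.countable_range fun n : ℤ => (n : ℝ) / 2).mono fun t ht => ?_
    obtain ⟨n, hn⟩ := Real.sin_eq_zero_iff.1 ht
    refine ⟨n, ?_⟩
    have := Real.pi_pos
    simp only
    field_simp
    nlinarith
  filter_upwards [hc.ae_notMem volume] with t ht using ht

theorem one_sub_abs_symbol_ge {d : ℕ} (i₀ : Fin d) (s : Fin d → ℝ) :
    Real.sin (2 * π * s i₀) ^ 2 / (2 * d) ≤
      1 - |(2 * ∑ i, Real.cos (2 * π * s i)) / (2 * d)| := by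
  have hd : (0 : ℝ) < d := by exact_mod_cast i₀.pos
  have h1 : |∑ i, Real.cos (2 * π * s i)| ≤ |Real.cos (2 * π * s i₀)| + (d - 1) := by
    refine (Finset.abs_sum_le_sum_abs _ _).trans ?_
    rw [← Finset.add_sum_erase _ _ (Finset.mem_univ i₀)]
    gcongr
    refine (Finset.sum_le_card_nsmul _ _ 1 fun i _ => Real.abs_cos_le_one _).trans ?_
    simp [Finset.card_erase_of_mem, Nat.cast_sub i₀.pos]
  have h2 : Real.sin (2 * π * s i₀) ^ 2 / 2 ≤ 1 - |Real.cos (2 * π * s i₀)| := by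
    rw [Real.sin_sq, ← sq_abs (Real.cos _)]
    nlinarith [sq_nonneg (|Real.cos (2 * π * s i₀)| - 1)]
  rw [mul_div_mul_left _ _ two_ne_zero, abs_div, abs_of_pos hd, ← div_div, le_sub_iff_add_le,
    ← add_div, div_le_one hd]
  linarith

theorem latticeTreeEntropy_eq_integral {d : ℕ} (hd : 1 ≤ d) :
    latticeTreeEntropy d =
      ∫ s, Real.log (2 * d - 2 * ∑ i : Fin d, Real.cos (2 * π * s i)) ∂cubeMeasure d := by
  have hd0 : (0 : ℝ) < d := by exact_mod_cast hd
  let i₀ : Fin d := ⟨0, hd⟩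
  let φ : (Fin d → ℝ) → ℝ := fun s => (2 * ∑ i, Real.cos (2 * π * s i)) / (2 * d)
  have hφ : Measurable φ := by fun_prop
  have hsin : ∀ᵐ s ∂cubeMeasure d, Real.sin (2 * π * s i₀) ≠ 0 :=
    (Measure.tendsto_eval_ae_ae (μ := fun _ : Fin d => volume.restrict (Set.Icc (0 : ℝ) 1))
      (i := i₀)).eventually ae_sin_two_pi_ne_zero
  have hpos : ∀ᵐ s ∂cubeMeasure d, 0 < Real.sin (2 * π * s i₀) ^ 2 / (2 * d) := by
    filter_upwards [hsin] with s hs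
    positivity
  have h1 : ∀ᵐ s ∂cubeMeasure d, |φ s| < 1 := by
    filter_upwards [hpos] with s hs
    linarith [one_sub_abs_symbol_ge i₀ s]
  have hint : Integrable (fun s => Real.log (1 - |φ s|)) (cubeMeasure d) := by
    have hb : Integrable (fun s : Fin d → ℝ =>
        Real.log (2 * d) - 2 * Real.log |Real.sin (2 * π * s i₀)|) (cubeMeasure d) :=
      (integrable_const _).sub ((integrable_comp_eval (i := i₀)
        (μ := fun _ : Fin d => volume.restrict (Set.Icc (0 : ℝ) 1))
        integrable_log_abs_sin_two_pi).const_mul 2)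
    have hmeas : Measurable fun s => 1 - |φ s| := by fun_prop
    refine hb.mono' hmeas.log.aestronglyMeasurable ?_
    filter_upwards [hsin, hpos, h1] with s hs hp hlt
    have hle := Real.log_le_log hp (one_sub_abs_symbol_ge i₀ s)
    rw [Real.log_div (by positivity) (by positivity), Real.log_pow, ← Real.log_abs] at hle
    rw [Real.norm_of_nonpos (Real.log_nonpos (by linarith) (by linarith [abs_nonneg (φ s)]))]
    push_cast at hle
    linarith
  obtain ⟨hlog, hsum⟩ := hasSum_integral_pow_div hφ h1 hint
  have hp (k : ℕ) : latticeRetProb d (k + 1) / (k + 1) =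
      ∫ s, φ s ^ (k + 1) / (k + 1) ∂cubeMeasure d := by
    rw [latticeRetProb_eq_integral, integral_div]
  simp only [latticeTreeEntropy, hp]
  rw [hsum.tsum_eq, sub_neg_eq_add]
  have hconst : Real.log (2 * d) = ∫ _, Real.log (2 * d) ∂cubeMeasure d := by simp
  rw [hconst, ← integral_add (integrable_const _) hlog]
  refine integral_congr_ae ?_
  filter_upwards [h1] with s hs
  have : 1 - φ s ≠ 0 := by linarith [le_abs_self (φ s)]
  rw [← Real.log_mul (by positivity) this]
  congr 1
  simp only [φ]
  field_simp

theorem norm_circleMap_sub_exp_sq (u θ : ℝ) :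
    ‖circleMap 0 1 θ - (Real.exp u : ℂ)‖ ^ 2 =
      Real.exp u * (2 * Real.cosh u - 2 * Real.cos θ) := by
  rw [← Complex.normSq_eq_norm_sq, Complex.normSq_apply, circleMap]
  simp only [Complex.sub_re, Complex.sub_im, Complex.ofReal_re, Complex.ofReal_im, zero_add,
    Complex.ofReal_one, one_mul, Complex.exp_ofReal_mul_I_re, Complex.exp_ofReal_mul_I_im]
  have h : Real.exp u * Real.exp (-u) = 1 := by rw [← Real.exp_add]; simp
  rw [Real.cosh_eq]
  linear_combination Real.sin_sq_add_cos_sq θ - h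

theorem log_two_cosh_sub_two_cos (u θ : ℝ) :
    Real.log (2 * Real.cosh u - 2 * Real.cos θ) =
      2 * Real.log ‖circleMap 0 1 θ - (Real.exp u : ℂ)‖ - u := by
  have key := norm_circleMap_sub_exp_sq u θ
  by_cases h : 2 * Real.cosh u - 2 * Real.cos θ = 0
  · have hu : u = 0 := by
      by_contra hu
      linarith [Real.one_lt_cosh.2 hu, Real.cos_le_one θ]
    rw [h, mul_zero, sq_eq_zero_iff] at key
    rw [h, key, hu]
    simp
  · have := congrArg Real.log key
    rw [Real.log_mul (Real.exp_pos u).ne' h, Real.log_pow, Real.log_exp, Nat.cast_ofNat] at this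
    linarith

/-- Jensen's formula for the polynomial `z ^ 2 - 2 * cosh u * z + 1`. -/
theorem integral_log_two_cosh_sub_two_cos {u : ℝ} (hu : 0 ≤ u) :
    ∫ y in (0 : ℝ)..1, Real.log (2 * Real.cosh u - 2 * Real.cos (2 * π * y)) = u := by
  have hint : IntervalIntegrable (fun θ => Real.log ‖circleMap 0 1 θ - (Real.exp u : ℂ)‖) volume
      0 (2 * π) := circleIntegrable_log_norm_sub_const 1
  have hav := circleAverage_log_norm_sub_const_eq_posLog (a := (Real.exp u : ℂ))
  rw [Real.circleAverage_def, Complex.norm_real, Real.norm_of_nonneg (Real.exp_pos u).le,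
    Real.posLog_eq_log (by rw [abs_of_pos (Real.exp_pos u)]; exact Real.one_le_exp hu),
    Real.log_exp, smul_eq_mul] at hav
  rw [intervalIntegral.integral_comp_mul_left
    (fun θ => Real.log (2 * Real.cosh u - 2 * Real.cos θ)) (by positivity : 2 * π ≠ 0)]
  simp only [log_two_cosh_sub_two_cos, mul_zero, mul_one, smul_eq_mul]
  rw [intervalIntegral.integral_sub (hint.const_mul 2) (by simp),
    intervalIntegral.integral_const_mul, intervalIntegral.integral_const, mul_sub, mul_left_comm,
    hav, smul_eq_mul]
  have := Real.pi_ne_zero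
  field_simp
  ring

theorem integral_log_four_sub_two_cos {x : ℝ} (hx : 0 ≤ Real.sin (π * x)) :
    ∫ y in (0 : ℝ)..1, Real.log (4 - 2 * Real.cos (2 * π * x) - 2 * Real.cos (2 * π * y)) =
      2 * Real.arsinh (Real.sin (π * x)) := by
  rw [← integral_log_two_cosh_sub_two_cos
    (mul_nonneg zero_le_two (Real.arsinh_nonneg_iff.2 hx))]
  have h : 2 * Real.cosh (2 * Real.arsinh (Real.sin (π * x))) = 4 - 2 * Real.cos (2 * π * x) := by
    rw [Real.cosh_two_mul, Real.cosh_sq, Real.sinh_arsinh, mul_assoc, Real.cos_two_mul, Real.cos_sq']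
    ring
  rw [h]

theorem arsinh_eq_integral (y : ℝ) :
    Real.arsinh y = ∫ b in (0 : ℝ)..1, y / √(1 + (b * y) ^ 2) := by
  have hd (b : ℝ) : HasDerivAt (fun b => Real.arsinh (b * y)) (y / √(1 + (b * y) ^ 2)) b := by
    have := (hasDerivAt_mul_const (x := b) y).arsinh
    simpa [div_eq_inv_mul] using this
  have hpos (b : ℝ) : √(1 + (b * y) ^ 2) ≠ 0 := by positivity
  rw [intervalIntegral.integral_eq_sub_of_hasDerivAt (fun b _ => hd b)
    (Continuous.intervalIntegrable (by fun_prop (disch := exact hpos _)) _ _)]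
  simp

theorem integral_sin_div_sqrt {b : ℝ} (hb : 0 < b) :
    ∫ t in (0 : ℝ)..π / 2, Real.sin t / √(1 + (b * Real.sin t) ^ 2) = Real.arctan b / b := by
  have hs : 0 < √(1 + b ^ 2) := by positivity
  have hs2 : √(1 + b ^ 2) ^ 2 = 1 + b ^ 2 := Real.sq_sqrt (by positivity)
  have hd (t : ℝ) : HasDerivAt (fun t => -Real.arcsin (b * Real.cos t / √(1 + b ^ 2)) / b)
      (Real.sin t / √(1 + (b * Real.sin t) ^ 2)) t := by
    have hlt : (b * Real.cos t / √(1 + b ^ 2)) ^ 2 < 1 := by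
      rw [div_pow, hs2, div_lt_one (by positivity), mul_pow]
      nlinarith [Real.sin_sq_add_cos_sq t, mul_nonneg (sq_nonneg b) (sq_nonneg (Real.sin t))]
    have hab := abs_lt.1 ((sq_lt_one_iff_abs_lt_one _).1 hlt)
    have hin := ((Real.hasDerivAt_cos t).const_mul b).div_const √(1 + b ^ 2)
    have h := (((Real.hasDerivAt_arcsin hab.1.ne' hab.2.ne).comp t hin).neg).div_const b
    refine h.congr_deriv ?_
    have hsq : 1 - (b * Real.cos t / √(1 + b ^ 2)) ^ 2 =
        (1 + (b * Real.sin t) ^ 2) / (1 + b ^ 2) := by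
      rw [div_pow, hs2, mul_pow b (Real.sin t), Real.sin_sq]
      field_simp
      ring
    rw [hsq, Real.sqrt_div (by positivity)]
    have : √(1 + (b * Real.sin t) ^ 2) ≠ 0 := by positivity
    field_simp
  have hpos (t : ℝ) : √(1 + (b * Real.sin t) ^ 2) ≠ 0 := by positivity
  rw [intervalIntegral.integral_eq_sub_of_hasDerivAt (fun t _ => hd t)
    (Continuous.intervalIntegrable (by fun_prop (disch := exact hpos _)) _ _),
    Real.arctan_eq_arcsin]
  simp [neg_div]

theorem integral_arctan_div :
    ∫ b in (0 : ℝ)..1, Real.arctan b / b = ∑' k : ℕ, (-1 : ℝ) ^ k / (2 * k + 1) ^ 2 := by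
  have hcont (k : ℕ) : Continuous fun b : ℝ => (-1 : ℝ) ^ k * b ^ (2 * k) / (2 * k + 1) := by
    fun_prop
  have hint (k : ℕ) : ∫ b in (0 : ℝ)..1, b ^ (2 * k) / (2 * k + 1 : ℝ) = 1 / (2 * k + 1) ^ 2 := by
    rw [intervalIntegral.integral_div, integral_pow]
    push_cast
    simp
    field_simp
  have hsummable : Summable fun k : ℕ => 1 / (2 * k + 1 : ℝ) ^ 2 := by
    have h := (Real.summable_one_div_nat_pow.2 one_lt_two).comp_injective
      (i := fun k : ℕ => 2 * k + 1) (fun a b h => by simpa using h)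
    refine h.congr fun k => ?_
    simp
  have hsum : HasSum (fun k : ℕ => ∫ b in Set.Ioc (0 : ℝ) 1, (-1 : ℝ) ^ k * b ^ (2 * k) / (2 * k + 1))
      (∫ b in Set.Ioc (0 : ℝ) 1, ∑' k : ℕ, (-1 : ℝ) ^ k * b ^ (2 * k) / (2 * k + 1)) := by
    refine hasSum_integral_of_summable_integral_norm
      (fun k => ((hcont k).intervalIntegrable 0 1).1) (hsummable.congr fun k => ?_)
    rw [← hint k, intervalIntegral.integral_of_le zero_le_one]
    refine setIntegral_congr_fun measurableSet_Ioc fun b _ => ?_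
    have h1 : (0 : ℝ) ≤ 2 * k + 1 := by positivity
    simp [abs_of_nonneg h1, pow_mul]
  rw [intervalIntegral.integral_of_le zero_le_one]
  trans ∫ b in Set.Ioc (0 : ℝ) 1, ∑' k : ℕ, (-1 : ℝ) ^ k * b ^ (2 * k) / (2 * k + 1)
  · rw [integral_Ioc_eq_integral_Ioo, integral_Ioc_eq_integral_Ioo]
    refine setIntegral_congr_fun measurableSet_Ioo fun b hb => ?_
    have h := (Real.hasSum_arctan (x := b)
      (by rw [Real.norm_of_nonneg hb.1.le]; exact hb.2)).div_const b
    refine h.tsum_eq.symm.trans (tsum_congr fun k => ?_)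
    have := hb.1.ne'
    push_cast
    field_simp
    ring
  · rw [← hsum.tsum_eq]
    refine tsum_congr fun k => ?_
    simp only [mul_div_assoc]
    rw [← intervalIntegral.integral_of_le zero_le_one, intervalIntegral.integral_const_mul, hint,
      mul_one_div]

theorem integral_arsinh_sin_pi_div_two :
    ∫ t in (0 : ℝ)..π / 2, Real.arsinh (Real.sin t) =
      ∑' k : ℕ, (-1 : ℝ) ^ k / (2 * k + 1) ^ 2 := by
  simp only [arsinh_eq_integral (Real.sin _)]
  have hpos (p : ℝ × ℝ) : √(1 + (p.2 * Real.sin p.1) ^ 2) ≠ 0 := by positivity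
  have hc : Continuous (fun p : ℝ × ℝ => Real.sin p.1 / √(1 + (p.2 * Real.sin p.1) ^ 2)) := by
    fun_prop (disch := exact hpos _)
  rw [intervalIntegral_intervalIntegral_swap
    (F := fun t b => Real.sin t / √(1 + (b * Real.sin t) ^ 2)), ← integral_arctan_div]
  · refine intervalIntegral.integral_congr_ae (Filter.Eventually.of_forall fun b hb => ?_)
    rw [Set.uIoc_of_le zero_le_one] at hb
    exact integral_sin_div_sqrt hb.1
  · refine (hc.continuousOn.integrableOn_compact
      (isCompact_uIcc.prod isCompact_uIcc)).mono_set
      (Set.prod_mono Set.uIoc_subset_uIcc Set.uIoc_subset_uIcc)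

theorem integral_arsinh_sin_pi_mul :
    ∫ x in (0 : ℝ)..1, Real.arsinh (Real.sin (π * x)) =
      2 * (∑' k : ℕ, (-1 : ℝ) ^ k / (2 * k + 1) ^ 2) / π := by
  have hc : Continuous fun t => Real.arsinh (Real.sin t) := Real.continuous_sin.arsinh
  have hsymm : ∫ t in π / 2..π, Real.arsinh (Real.sin t) =
      ∫ t in (0 : ℝ)..π / 2, Real.arsinh (Real.sin t) := by
    have h := intervalIntegral.integral_comp_sub_left
      (fun t => Real.arsinh (Real.sin t)) (a := π / 2) (b := π) π
    simpa [Real.sin_pi_sub, sub_half] using h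
  rw [intervalIntegral.integral_comp_mul_left (fun t => Real.arsinh (Real.sin t)) Real.pi_ne_zero,
    mul_zero, mul_one, ← intervalIntegral.integral_add_adjacent_intervals
      (hc.intervalIntegrable 0 (π / 2)) (hc.intervalIntegrable (π / 2) π), hsymm,
    integral_arsinh_sin_pi_div_two, smul_eq_mul]
  ring

theorem integral_integral_log_four_sub_two_cos :
    ∫ x in (0 : ℝ)..1, ∫ y in (0 : ℝ)..1,
        Real.log (4 - 2 * Real.cos (2 * π * x) - 2 * Real.cos (2 * π * y)) =
      4 * (∑' k : ℕ, (-1 : ℝ) ^ k / (2 * k + 1) ^ 2) / π := by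
  have h : ∫ x in (0 : ℝ)..1, ∫ y in (0 : ℝ)..1,
        Real.log (4 - 2 * Real.cos (2 * π * x) - 2 * Real.cos (2 * π * y)) =
      ∫ x in (0 : ℝ)..1, 2 * Real.arsinh (Real.sin (π * x)) := by
    refine intervalIntegral.integral_congr fun x hx => ?_
    rw [Set.uIcc_of_le zero_le_one] at hx
    exact integral_log_four_sub_two_cos (Real.sin_nonneg_of_nonneg_of_le_pi
      (mul_nonneg Real.pi_pos.le hx.1) (mul_le_of_le_one_right Real.pi_pos.le hx.2))
  rw [h, intervalIntegral.integral_const_mul, integral_arsinh_sin_pi_mul]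
  ring

/-- Proposition: the tree entropy of the hypercubic lattice `ℤ^d` is
`∫_{[0,1]^d} log(2d - 2∑_i cos(2π s_i)) ds`; in particular for `d = 2` this double integral
equals `4C/π` with `C` Catalan's constant. -/
theorem stmt13 (d : ℕ) (hd : 1 ≤ d) :
    (latticeTreeEntropy d =
        ∫ s in Set.univ.pi (fun _ : Fin d => Set.Icc (0 : ℝ) 1),
          Real.log (2 * d - 2 * ∑ i : Fin d, Real.cos (2 * π * s i))) ∧
      ((∫ x in (0 : ℝ)..1, ∫ y in (0 : ℝ)..1,
          Real.log (4 - 2 * Real.cos (2 * π * x) - 2 * Real.cos (2 * π * y))) =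
        4 * (∑' k : ℕ, (-1 : ℝ) ^ k / (2 * k + 1) ^ 2) / π) := by
  rw [volume_restrict_cube]
  exact ⟨latticeTreeEntropy_eq_integral hd, integral_integral_log_four_sub_two_cos⟩
end

section
/- Among all infinite transitive graphs G of degree d ≥ 3, the tree entropy h(G) = log d - ∑_{k≥1} p_k(o;G)/k is maximized uniquely by the d-regular tree T, with maximum value log((d-1)^{d-1}/(d(d-2))^{d/2-1}). -/
/-- The `k`-step return probability at `o` of simple random walk on a `d`-regular graph `G`. -/
noncomputable def walkRetProb {V : Type*} (G : SimpleGraph V) (d : ℕ) (o : V) (k : ℕ) : ℝ :=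
  (Nat.card {w : G.Walk o o // w.length = k} : ℝ) / d ^ k

/-- The tree entropy of a `d`-regular graph `G`: `log d - ∑_{k≥1} p_k(o;G)/k`. -/
noncomputable def treeEntropy {V : Type*} (G : SimpleGraph V) (d : ℕ) (o : V) : ℝ :=
  Real.log d - ∑' k : ℕ, walkRetProb G d o (k + 1) / (k + 1)

/-- The adjacency operator of the `d`-regular tree acting on functions of the distance
to a fixed root. -/
noncomputable def treeOp (d : ℝ) : (ℕ → ℝ) →ₗ[ℝ] (ℕ → ℝ) where
  toFun f n := match n with
    | 0 => d * f 1
    | n + 1 => f n + (d - 1) * f (n + 2)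
  map_add' f g := by
    ext n
    cases n <;> simp <;> ring
  map_smul' c f := by
    ext n
    cases n <;> simp <;> ring

@[simp] theorem treeOp_zero (d : ℝ) (f : ℕ → ℝ) : treeOp d f 0 = d * f 1 := rfl

@[simp] theorem treeOp_succ (d : ℝ) (f : ℕ → ℝ) (n : ℕ) :
    treeOp d f (n + 1) = f n + (d - 1) * f (n + 2) := rfl

/-- The number of walks of length `k` in the `d`-regular tree from a vertex at distance `n`
from the root to the root. -/
noncomputable def treeCount (d : ℝ) (k : ℕ) : ℕ → ℝ := (treeOp d ^ k) (Pi.single 0 1)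

@[simp] theorem treeCount_zero_zero (d : ℝ) : treeCount d 0 0 = 1 := by simp [treeCount]

@[simp] theorem treeCount_zero_succ (d : ℝ) (n : ℕ) : treeCount d 0 (n + 1) = 0 := by
  simp [treeCount]

theorem treeCount_succ (d : ℝ) (k : ℕ) : treeCount d (k + 1) = treeOp d (treeCount d k) := by
  simp [treeCount, pow_succ']

/-- The number of walks of length `k` from `v` to `o`, as a real number. -/
noncomputable def walkCount {V : Type*} (G : SimpleGraph V) (o : V) (k : ℕ) (v : V) : ℝ :=
  Nat.card {p : G.Walk v o // p.length = k}

section WalkCount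

variable {V : Type*} {G : SimpleGraph V}

theorem subsingleton_walk_length_zero (o v : V) :
    Subsingleton {p : G.Walk v o // p.length = 0} := by
  refine ⟨?_⟩
  rintro ⟨p, hp⟩ ⟨q, hq⟩
  cases p with
  | nil => cases q with
    | nil => rfl
    | cons => simp at hq
  | cons => simp at hp

theorem walkCount_zero_self (o : V) : walkCount G o 0 o = 1 := by
  rw [walkCount, Nat.card_eq_one_iff_unique.2 ⟨subsingleton_walk_length_zero o o, ⟨⟨.nil, rfl⟩⟩⟩,
    Nat.cast_one]

theorem walkCount_zero_of_ne {o v : V} (h : v ≠ o) : walkCount G o 0 v = 0 := by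
  have : IsEmpty {p : G.Walk v o // p.length = 0} :=
    ⟨fun ⟨_, hp⟩ ↦ h (SimpleGraph.Walk.eq_of_length_eq_zero hp)⟩
  rw [walkCount, Nat.card_of_isEmpty, Nat.cast_zero]

/-- A walk of positive length is determined by its first step and the remaining walk. -/
def walkSuccEquiv (G : SimpleGraph V) (v o : V) (k : ℕ) :
    {p : G.Walk v o // p.length = k + 1} ≃
      Σ w : G.neighborSet v, {p : G.Walk w o // p.length = k} where
  toFun p := match p with
    | ⟨.cons (v := w) h q, hp⟩ => ⟨⟨w, h⟩, ⟨q, by simpa using hp⟩⟩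
  invFun x := match x with
    | ⟨⟨_, h⟩, ⟨q, hq⟩⟩ => ⟨.cons h q, congrArg (· + 1) hq⟩
  left_inv p := match p with
    | ⟨.cons h q, hp⟩ => rfl
  right_inv _ := rfl

variable [∀ v, Fintype (G.neighborSet v)]

theorem finite_walk_length (o : V) (k : ℕ) (v : V) :
    Finite {p : G.Walk v o // p.length = k} := by
  induction k generalizing v with
  | zero =>
    have := subsingleton_walk_length_zero (G := G) o v
    infer_instance
  | succ k ih => exact Finite.of_equiv _ (walkSuccEquiv G v o k).symm

theorem walkCount_succ (o : V) (k : ℕ) (v : V) :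
    walkCount G o (k + 1) v = ∑ w ∈ G.neighborFinset v, walkCount G o k w := by
  have := finite_walk_length (G := G) o k
  rw [walkCount, Nat.card_congr (walkSuccEquiv G v o k), Nat.card_sigma]
  push_cast
  exact (Finset.sum_subtype (G.neighborFinset v) (by simp) (walkCount G o k)).symm

end WalkCount

/-- `NonBacktracking G o v w n` asserts that there is a non-backtracking walk of length `n + 1`
from `v` to `o` whose first step goes to `w`. -/
inductive NonBacktracking {V : Type*} (G : SimpleGraph V) (o : V) : V → V → ℕ → Prop
  | single {v : V} : G.Adj v o → NonBacktracking G o v o 0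
  | cons {v w x : V} {n : ℕ} : NonBacktracking G o w x n → G.Adj v w → v ≠ x →
      NonBacktracking G o v w (n + 1)

section Comparison

variable {V : Type*} {G : SimpleGraph V} {o : V}

theorem NonBacktracking.adj {v w : V} {n : ℕ} (h : NonBacktracking G o v w n) : G.Adj v w := by
  cases h <;> assumption

theorem SimpleGraph.Walk.IsPath.nonBacktracking {v w : V} {p : G.Walk w o} (h : G.Adj v w)
    (hp : p.IsPath) (he : s(v, w) ∉ p.edges) : NonBacktracking G o v w p.length := by
  induction p generalizing v with
  | nil => exact .single h
  | cons h' q ih =>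
    rw [SimpleGraph.Walk.cons_isPath_iff] at hp
    refine .cons (ih h' hp.1 fun hm ↦ hp.2 (q.fst_mem_support_of_mem_edges hm)) h ?_
    rintro rfl
    exact he (by simp [Sym2.eq_swap])

/-- In an acyclic graph, non-backtracking walks are paths. -/
theorem SimpleGraph.IsAcyclic.exists_isPath_of_nonBacktracking (hG : G.IsAcyclic) {v w : V} {n : ℕ}
    (h : NonBacktracking G o v w n) : ∃ p : G.Walk v o, p.IsPath ∧ p.length = n + 1 ∧ p.snd = w := by
  induction h with
  | single h => exact ⟨h.toWalk, by simp [h.ne], by simp, by simp⟩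
  | @cons v w x n _ h hne ih =>
    obtain ⟨p, hp, hl, rfl⟩ := ih
    refine ⟨.cons h p, ?_, by simp [hl], by simp⟩
    rw [SimpleGraph.Walk.cons_isPath_iff]
    exact ⟨hp, fun hm ↦ hne (hG.eq_snd_of_adj_start hp h.symm hm)⟩

theorem SimpleGraph.IsAcyclic.not_nonBacktracking (hG : G.IsAcyclic) {w : V} {n : ℕ} :
    ¬ NonBacktracking G o o w n := by
  intro h
  obtain ⟨p, hp, hl, -⟩ := hG.exists_isPath_of_nonBacktracking h
  rw [SimpleGraph.Walk.isPath_iff_nil, ← SimpleGraph.Walk.length_eq_zero_iff] at hp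
  omega

variable [∀ v, Fintype (G.neighborSet v)] {d : ℕ}

open Classical in
theorem sum_neighborFinset_ite (hreg : ∀ v, G.degree v = d) {v x : V} (h : G.Adj v x) (a b : ℝ) :
    ∑ w ∈ G.neighborFinset v, (if w = x then a else b) = a + (d - 1) * b := by
  have hx : x ∈ G.neighborFinset v := by simpa using h
  rw [← Finset.add_sum_erase _ _ hx, Finset.sum_congr rfl
    (g := fun _ ↦ b) (fun w hw ↦ if_neg (Finset.ne_of_mem_erase hw)), Finset.sum_const,
    Finset.card_erase_of_mem hx, if_pos rfl, G.card_neighborFinset_eq_degree, hreg, nsmul_eq_mul,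
    Nat.cast_sub (by rw [← hreg v]; exact (G.degree_pos_iff_exists_adj v).2 ⟨x, h⟩)]
  simp

theorem treeCount_le_walkCount (hreg : ∀ v, G.degree v = d) (k : ℕ) :
    treeCount d k 0 ≤ walkCount G o k o ∧
      ∀ v w n, NonBacktracking G o v w n → treeCount d k (n + 1) ≤ walkCount G o k v := by
  classical
  induction k with
  | zero =>
    refine ⟨by simp [walkCount_zero_self], fun v w n _ ↦ ?_⟩
    rw [treeCount_zero_succ]
    exact Nat.cast_nonneg _
  | succ k ih =>
    constructor
    · rw [treeCount_succ, walkCount_succ, treeOp_zero, ← hreg o, ← G.card_neighborFinset_eq_degree,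
        ← nsmul_eq_mul]
      refine Finset.card_nsmul_le_sum _ _ _ fun w hw ↦ ?_
      rw [G.card_neighborFinset_eq_degree, hreg]
      exact ih.2 w o 0 (.single ((G.mem_neighborFinset _ _).1 hw).symm)
    · intro v w n h
      rw [treeCount_succ, walkCount_succ, treeOp_succ, ← sum_neighborFinset_ite hreg h.adj]
      refine Finset.sum_le_sum fun w' hw' ↦ ?_
      split_ifs with hw
      · subst hw
        cases h with
        | single => exact ih.1
        | cons h' => exact ih.2 _ _ _ h'
      · exact ih.2 _ _ _ (.cons h ((G.mem_neighborFinset _ _).1 hw').symm hw)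

theorem SimpleGraph.IsAcyclic.walkCount_eq (hG : G.IsAcyclic) (hreg : ∀ v, G.degree v = d)
    (k : ℕ) : walkCount G o k o = treeCount d k 0 ∧
      ∀ v w n, NonBacktracking G o v w n → walkCount G o k v = treeCount d k (n + 1) := by
  classical
  induction k with
  | zero =>
    refine ⟨by simp [walkCount_zero_self], fun v w n h ↦ ?_⟩
    rw [treeCount_zero_succ]
    refine walkCount_zero_of_ne ?_
    rintro rfl
    exact hG.not_nonBacktracking h
  | succ k ih =>
    constructor
    · rw [treeCount_succ, walkCount_succ, treeOp_zero, ← hreg o, ← G.card_neighborFinset_eq_degree,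
        ← nsmul_eq_mul]
      refine Finset.sum_eq_card_nsmul fun w hw ↦ ?_
      rw [G.card_neighborFinset_eq_degree, hreg]
      exact ih.2 w o 0 (.single ((G.mem_neighborFinset _ _).1 hw).symm)
    · intro v w n h
      rw [treeCount_succ, walkCount_succ, treeOp_succ, ← sum_neighborFinset_ite hreg h.adj]
      refine Finset.sum_congr rfl fun w' hw' ↦ ?_
      split_ifs with hw
      · subst hw
        cases h with
        | single => exact ih.1
        | cons h' => exact ih.2 _ _ _ h'
      · exact ih.2 _ _ _ (.cons h ((G.mem_neighborFinset _ _).1 hw').symm hw)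

/-- If the return counts at `o` agree with those of the tree, then so do the walk counts from the
starting point of any non-backtracking walk to `o`. -/
theorem NonBacktracking.walkCount_eq (hreg : ∀ v, G.degree v = d)
    (heq : ∀ k, walkCount G o k o = treeCount d k 0) {v w : V} {n : ℕ}
    (h : NonBacktracking G o v w n) (k : ℕ) : walkCount G o k v = treeCount d k (n + 1) := by
  classical
  induction h generalizing k with
  | @single v h =>
    have hs := heq (k + 1)
    rw [treeCount_succ, walkCount_succ, treeOp_zero, ← hreg o, ← G.card_neighborFinset_eq_degree,
        ← nsmul_eq_mul, ← Finset.sum_const, eq_comm, Finset.sum_eq_sum_iff_of_le] at hs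
    · have := hs v (by simpa using h.symm)
      rw [← this, G.card_neighborFinset_eq_degree, hreg]
    · intro w hw
      rw [G.card_neighborFinset_eq_degree, hreg]
      exact (treeCount_le_walkCount hreg k).2 w o 0 (.single ((G.mem_neighborFinset _ _).1 hw).symm)
  | @cons v w x n h hadj hne ih =>
    have hs := ih (k + 1)
    rw [treeCount_succ, walkCount_succ, treeOp_succ, ← sum_neighborFinset_ite hreg h.adj, eq_comm,
      Finset.sum_eq_sum_iff_of_le] at hs
    · have := hs v (by simpa using hadj.symm)
      rw [← this, if_neg hne]
    · intro w' hw'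
      split_ifs with hw
      · subst hw
        cases h with
        | single => exact (treeCount_le_walkCount hreg k).1
        | cons h' => exact (treeCount_le_walkCount hreg k).2 _ _ _ h'
      · exact (treeCount_le_walkCount hreg k).2 _ _ _
          (.cons h ((G.mem_neighborFinset _ _).1 hw').symm hw)

theorem isAcyclic_iff_walkCount_eq (htr : ∀ u v : V, ∃ e : G ≃g G, e u = v)
    (hreg : ∀ v, G.degree v = d) (o : V) :
    G.IsAcyclic ↔ ∀ k, walkCount G o k o = treeCount d k 0 := by
  refine ⟨fun h k ↦ (h.walkCount_eq hreg k).1, fun heq v c hc ↦ ?_⟩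
  obtain ⟨e, rfl⟩ := htr v o
  have hc' := hc.map (f := e.toHom) e.injective
  generalize c.map e.toHom = c' at hc'
  cases c' with
  | nil => exact hc'.not_nil .nil
  | cons h q =>
    rw [SimpleGraph.Walk.cons_isCycle_iff] at hc'
    have := (hc'.1.nonBacktracking h hc'.2).walkCount_eq hreg heq 0
    rw [treeCount_zero_succ] at this
    exact one_ne_zero (walkCount_zero_self (G := G) (e v) ▸ this)

end Comparison

section Summability

variable {V : Type*} {G : SimpleGraph V} {d : ℕ}

/-- The probability that simple random walk started at `v` is at `o` at time `k`. -/
noncomputable def hitProb (G : SimpleGraph V) (d : ℕ) (o : V) (k : ℕ) (v : V) : ℝ :=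
  walkCount G o k v / d ^ k

theorem hitProb_nonneg (o : V) (k : ℕ) (v : V) : 0 ≤ hitProb G d o k v := by
  rw [hitProb, walkCount]
  positivity

theorem hitProb_zero_self (o : V) : hitProb G d o 0 o = 1 := by
  simp [hitProb, walkCount_zero_self]

theorem hitProb_zero_of_ne {o v : V} (h : v ≠ o) : hitProb G d o 0 v = 0 := by
  simp [hitProb, walkCount_zero_of_ne h]

variable [∀ v, Fintype (G.neighborSet v)]

/-- The transition operator of simple random walk on a `d`-regular graph. -/
noncomputable def walkOp (G : SimpleGraph V) [∀ v, Fintype (G.neighborSet v)] (d : ℕ)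
    (f : V → ℝ) (v : V) : ℝ :=
  (∑ w ∈ G.neighborFinset v, f w) / d

theorem mul_walkOp (hd : 0 < d) (f : V → ℝ) (v : V) :
    d * walkOp G d f v = ∑ w ∈ G.neighborFinset v, f w := by
  rw [walkOp]
  field_simp

open Classical in
theorem sum_neighborFinset_eq_sum {S : Finset V} {f : V → ℝ} (hf : ∀ v ∉ S, f v = 0) (v : V) :
    ∑ w ∈ G.neighborFinset v, f w = ∑ w ∈ S, if G.Adj v w then f w else 0 := by
  rw [← Finset.sum_filter]
  refine (Finset.sum_subset_zero_on_sdiff (fun w hw ↦ ?_) (fun w hw ↦ ?_) fun _ _ ↦ rfl).symm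
  · simpa using (Finset.mem_filter.1 hw).2
  · simp only [Finset.mem_sdiff, G.mem_neighborFinset, Finset.mem_filter, not_and] at hw
    exact hf w fun h ↦ hw.2 h hw.1

theorem sum_walkOp_mul {S : Finset V} {f g : V → ℝ} (hf : ∀ v ∉ S, f v = 0)
    (hg : ∀ v ∉ S, g v = 0) :
    ∑ v ∈ S, walkOp G d f v * g v = ∑ v ∈ S, f v * walkOp G d g v := by
  classical
  simp only [walkOp, sum_neighborFinset_eq_sum hf, sum_neighborFinset_eq_sum hg, Finset.sum_div,
    Finset.sum_mul, Finset.mul_sum]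
  rw [Finset.sum_comm]
  refine Finset.sum_congr rfl fun v _ ↦ Finset.sum_congr rfl fun w _ ↦ ?_
  simp only [G.adj_comm v w]
  split_ifs <;> ring

theorem sum_walkOp_le (hd : 0 < d) (hreg : ∀ v, G.degree v = d) {S : Finset V} {f : V → ℝ}
    (hf : ∀ v ∉ S, f v = 0) (hf0 : ∀ v, 0 ≤ f v) :
    ∑ v ∈ S, walkOp G d f v ≤ ∑ v ∈ S, f v := by
  classical
  have hd' : (0 : ℝ) < d := by exact_mod_cast hd
  simp only [walkOp, sum_neighborFinset_eq_sum hf]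
  rw [← Finset.sum_div, div_le_iff₀ hd', Finset.sum_comm, Finset.sum_mul]
  refine Finset.sum_le_sum fun w _ ↦ ?_
  rw [← Finset.sum_filter, Finset.sum_const, nsmul_eq_mul, mul_comm]
  refine mul_le_mul_of_nonneg_left ?_ (hf0 w)
  rw [← hreg w, ← G.card_neighborFinset_eq_degree]
  exact_mod_cast Finset.card_le_card fun v hv ↦ by simpa using (Finset.mem_filter.1 hv).2.symm

theorem dirichlet_le (hd : 0 < d) (hreg : ∀ v, G.degree v = d) {S : Finset V} {g : V → ℝ}
    (hg : ∀ v ∉ S, g v = 0) :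
    ∑ v ∈ S, ∑ w ∈ G.neighborFinset v, (g v - g w) ^ 2 ≤
      2 * d * (∑ v ∈ S, g v * g v - ∑ v ∈ S, g v * walkOp G d g v) := by
  have h : ∀ v, ∑ w ∈ G.neighborFinset v, (g v - g w) ^ 2 =
      d * (g v * g v) - 2 * d * (g v * walkOp G d g v) + d * walkOp G d (fun w ↦ g w * g w) v := by
    intro v
    have h1 : ∀ w, (g v - g w) ^ 2 = g v * g v - 2 * g v * g w + g w * g w := fun w ↦ by ring
    rw [mul_walkOp hd, show 2 * d * (g v * walkOp G d g v) = 2 * g v * (d * walkOp G d g v) by ring,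
      mul_walkOp hd, Finset.mul_sum]
    simp only [h1, Finset.sum_add_distrib, Finset.sum_sub_distrib, Finset.sum_const,
      G.card_neighborFinset_eq_degree, hreg, nsmul_eq_mul]
  have h2 := sum_walkOp_le hd hreg (S := S) (f := fun w ↦ g w * g w)
    (fun v hv ↦ by simp [hg v hv]) (fun v ↦ mul_self_nonneg _)
  simp only [h, Finset.sum_add_distrib, Finset.sum_sub_distrib, ← Finset.mul_sum]
  have hd' : (0 : ℝ) < d := by exact_mod_cast hd
  nlinarith [mul_le_mul_of_nonneg_left h2 hd'.le]

/-- A one-dimensional Nash-type inequality, valid on every infinite connected graph. -/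
theorem pow_three_le_dirichlet [Infinite V] (hconn : G.Connected) {S : Finset V} {g : V → ℝ}
    (hg : ∀ v ∉ S, g v = 0) (hg0 : ∀ v, 0 ≤ g v) (hsum : ∑ v ∈ S, g v ≤ 2) (o : V) :
    g o ^ 3 ≤ 16 * ∑ v ∈ S, ∑ w ∈ G.neighborFinset v, (g v - g w) ^ 2 := by
  classical
  have hE : 0 ≤ ∑ v ∈ S, ∑ w ∈ G.neighborFinset v, (g v - g w) ^ 2 := by positivity
  rcases (hg0 o).eq_or_lt with h0 | hpos
  · rw [← h0]
    linarith
  set A := S.filter fun v ↦ g o / 2 < g v with hA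
  have hmemA : ∀ v, v ∉ A → g v ≤ g o / 2 := by
    intro v hv
    by_cases hS : v ∈ S
    · simpa [hA, hS] using hv
    · rw [hg v hS]
      positivity
  have hcard : (A.card : ℝ) * g o ≤ 4 := by
    have h1 : A.card • (g o / 2) ≤ ∑ v ∈ A, g v :=
      Finset.card_nsmul_le_sum _ _ _ fun v hv ↦ (Finset.mem_filter.1 hv).2.le
    have h2 : ∑ v ∈ A, g v ≤ ∑ v ∈ S, g v :=
      Finset.sum_le_sum_of_subset_of_nonneg (Finset.filter_subset _ _) fun v _ _ ↦ hg0 v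
    rw [nsmul_eq_mul] at h1
    linarith
  obtain ⟨v, hv, hmin⟩ : ∃ v, v ∉ A ∧ ∀ w, w ∉ A → G.dist o v ≤ G.dist o w := by
    obtain ⟨x, hx⟩ := Infinite.exists_notMem_finset A
    obtain ⟨v, hv, hmin⟩ := exists_minimalFor_of_wellFoundedLT (· ∉ A) (G.dist o) ⟨x, hx⟩
    exact ⟨v, hv, fun w hw ↦ (le_total _ _).elim id (hmin hw)⟩
  obtain ⟨p, hp, hlen⟩ := hconn.exists_path_of_dist o v
  have hin : ∀ i < p.length, p.getVert i ∈ A := by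
    intro i hi
    by_contra h
    have h1 := hmin _ h
    have h2 := SimpleGraph.dist_le (p.take i)
    rw [SimpleGraph.Walk.take_length] at h2
    omega
  have hinj : Set.InjOn p.getVert (Finset.range p.length) := fun i hi j hj h ↦
    hp.getVert_injOn (Finset.mem_range.1 hi).le (Finset.mem_range.1 hj).le h
  have hn : p.length ≤ A.card := by
    rw [← Finset.card_range p.length, ← Finset.card_image_of_injOn hinj]
    refine Finset.card_le_card fun x hx ↦ ?_
    obtain ⟨i, hi, rfl⟩ := Finset.mem_image.1 hx
    exact hin i (Finset.mem_range.1 hi)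
  have htel : g o / 2 ≤ ∑ i ∈ Finset.range p.length, (g (p.getVert i) - g (p.getVert (i + 1))) := by
    rw [Finset.sum_range_sub' (fun i ↦ g (p.getVert i))]
    simp only [SimpleGraph.Walk.getVert_zero, SimpleGraph.Walk.getVert_length]
    linarith [hmemA v hv]
  have hcs := sq_sum_le_card_mul_sum_sq (s := Finset.range p.length)
    (f := fun i ↦ g (p.getVert i) - g (p.getVert (i + 1)))
  have hedge : ∑ i ∈ Finset.range p.length, (g (p.getVert i) - g (p.getVert (i + 1))) ^ 2 ≤
      ∑ v ∈ S, ∑ w ∈ G.neighborFinset v, (g v - g w) ^ 2 := by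
    calc _ ≤ ∑ i ∈ Finset.range p.length,
          ∑ w ∈ G.neighborFinset (p.getVert i), (g (p.getVert i) - g w) ^ 2 := by
          refine Finset.sum_le_sum fun i hi ↦ ?_
          refine Finset.single_le_sum (f := fun w ↦ (g (p.getVert i) - g w) ^ 2)
            (fun w _ ↦ sq_nonneg _) ?_
          rw [G.mem_neighborFinset]
          exact p.adj_getVert_succ (Finset.mem_range.1 hi)
      _ = ∑ v ∈ (Finset.range p.length).image p.getVert,
          ∑ w ∈ G.neighborFinset v, (g v - g w) ^ 2 := (Finset.sum_image
          (f := fun v ↦ ∑ w ∈ G.neighborFinset v, (g v - g w) ^ 2) hinj).symm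
      _ ≤ _ := by
          refine Finset.sum_le_sum_of_subset_of_nonneg (fun x hx ↦ ?_) fun v _ _ ↦ by positivity
          obtain ⟨i, hi, rfl⟩ := Finset.mem_image.1 hx
          exact (Finset.mem_filter.1 (hin i (Finset.mem_range.1 hi))).1
  rw [Finset.card_range] at hcs
  set E := ∑ v ∈ S, ∑ w ∈ G.neighborFinset v, (g v - g w) ^ 2
  have hsq : (g o / 2) ^ 2 ≤ A.card * E := by
    calc (g o / 2) ^ 2 ≤ _ := pow_le_pow_left₀ (by positivity) htel 2
      _ ≤ _ := hcs
      _ ≤ A.card * E := by gcongr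
  nlinarith [mul_le_mul_of_nonneg_right hsq hpos.le, mul_le_mul_of_nonneg_right hcard hE]

theorem hitProb_succ (o : V) (k : ℕ) :
    hitProb G d o (k + 1) = walkOp G d (hitProb G d o k) := by
  ext v
  simp only [hitProb, walkOp, walkCount_succ, ← Finset.sum_div, pow_succ, div_div]

theorem walkOp_add (f g : V → ℝ) : walkOp G d (f + g) = walkOp G d f + walkOp G d g := by
  ext v
  simp [walkOp, Finset.sum_add_distrib, add_div]

theorem exists_finset_hitProb_eq_zero (o : V) (n : ℕ) :
    ∃ S : Finset V, o ∈ S ∧ ∀ k ≤ n, ∀ v ∉ S, hitProb G d o k v = 0 := by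
  classical
  induction n with
  | zero =>
    refine ⟨{o}, by simp, fun k hk v hv ↦ ?_⟩
    rw [Nat.le_zero.1 hk, hitProb, walkCount_zero_of_ne (by simpa using hv), zero_div]
  | succ n ih =>
    obtain ⟨S, ho, hS⟩ := ih
    refine ⟨S ∪ S.biUnion fun v ↦ G.neighborFinset v, by simp [ho], fun k hk v hv ↦ ?_⟩
    simp only [Finset.mem_union, Finset.mem_biUnion, not_or, not_exists, not_and] at hv
    rcases hk.lt_or_eq with hk | rfl
    · exact hS k (Nat.lt_succ_iff.1 hk) v hv.1
    · rw [hitProb_succ, walkOp, Finset.sum_eq_zero, zero_div]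
      intro w hw
      refine hS n le_rfl w fun hwS ↦ hv.2 w hwS ?_
      rw [G.mem_neighborFinset] at hw ⊢
      exact hw.symm

theorem sum_hitProb_le (hd : 0 < d) (hreg : ∀ v, G.degree v = d) {o : V} {S : Finset V} {n : ℕ}
    (ho : o ∈ S) (hS : ∀ k ≤ n, ∀ v ∉ S, hitProb G d o k v = 0) {k : ℕ} (hk : k ≤ n) :
    ∑ v ∈ S, hitProb G d o k v ≤ 1 := by
  induction k with
  | zero =>
    rw [Finset.sum_eq_single_of_mem o ho fun v _ hv ↦ hitProb_zero_of_ne hv, hitProb_zero_self]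
  | succ k ih =>
    rw [hitProb_succ]
    exact (sum_walkOp_le hd hreg (hS k (by omega)) (hitProb_nonneg o k)).trans (ih (by omega))

theorem sum_hitProb_mul {o : V} {S : Finset V} {n : ℕ}
    (ho : o ∈ S) (hS : ∀ k ≤ n, ∀ v ∉ S, hitProb G d o k v = 0) {a b : ℕ} (hab : a + b ≤ n) :
    ∑ v ∈ S, hitProb G d o a v * hitProb G d o b v = hitProb G d o (a + b) o := by
  induction a generalizing b with
  | zero =>
    rw [Finset.sum_eq_single_of_mem o ho fun v _ hv ↦ by rw [hitProb_zero_of_ne hv, zero_mul],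
      hitProb_zero_self, one_mul, zero_add]
  | succ a ih =>
    rw [hitProb_succ, sum_walkOp_mul (hS a (by omega)) (hS b (by omega)), ← hitProb_succ,
      ih (by omega), show a + (b + 1) = a + 1 + b by ring]

theorem hitProb_pow_three_le [Infinite V] (hconn : G.Connected) (hd : 0 < d)
    (hreg : ∀ v, G.degree v = d) (o : V) (n : ℕ) :
    (hitProb G d o n o + hitProb G d o (n + 1) o) ^ 3 ≤
      32 * d * ((hitProb G d o (2 * n) o + hitProb G d o (2 * n + 1) o) -
        (hitProb G d o (2 * (n + 1)) o + hitProb G d o (2 * (n + 1) + 1) o)) := by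
  obtain ⟨S, ho, hS⟩ := exists_finset_hitProb_eq_zero (G := G) (d := d) o (2 * n + 3)
  set g := hitProb G d o n + hitProb G d o (n + 1) with hgdef
  have hg : ∀ v ∉ S, g v = 0 := fun v hv ↦ by
    simp [g, hS n (by omega) v hv, hS (n + 1) (by omega) v hv]
  have hg0 : ∀ v, 0 ≤ g v := fun v ↦ add_nonneg (hitProb_nonneg _ _ _) (hitProb_nonneg _ _ _)
  have hsum : ∑ v ∈ S, g v ≤ 2 := by
    have h1 := sum_hitProb_le hd hreg ho hS (k := n) (by omega)
    have h2 := sum_hitProb_le hd hreg ho hS (k := n + 1) (by omega)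
    simp only [g, Pi.add_apply, Finset.sum_add_distrib]
    linarith
  have h1 := pow_three_le_dirichlet hconn hg hg0 hsum o
  have h2 := dirichlet_le hd hreg hg
  have h3 : ∑ v ∈ S, g v * g v = hitProb G d o (2 * n) o + 2 * hitProb G d o (2 * n + 1) o +
      hitProb G d o (2 * n + 2) o := by
    simp only [g, Pi.add_apply, add_mul, mul_add, Finset.sum_add_distrib]
    rw [sum_hitProb_mul ho hS (by omega), sum_hitProb_mul ho hS (by omega),
      sum_hitProb_mul ho hS (by omega), sum_hitProb_mul ho hS (by omega),
      show n + n = 2 * n by ring, show n + 1 + n = 2 * n + 1 by ring,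
      show n + (n + 1) = 2 * n + 1 by ring, show n + 1 + (n + 1) = 2 * n + 2 by ring]
    ring
  have h4 : ∑ v ∈ S, g v * walkOp G d g v = hitProb G d o (2 * n + 1) o +
      2 * hitProb G d o (2 * n + 2) o + hitProb G d o (2 * n + 3) o := by
    rw [hgdef, walkOp_add, ← hitProb_succ, ← hitProb_succ]
    simp only [Pi.add_apply, add_mul, mul_add, Finset.sum_add_distrib]
    rw [sum_hitProb_mul ho hS (by omega), sum_hitProb_mul ho hS (by omega),
      sum_hitProb_mul ho hS (by omega), sum_hitProb_mul ho hS (by omega),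
      show n + (n + 1) = 2 * n + 1 by ring, show n + 1 + (n + 1) = 2 * n + 2 by ring,
      show n + (n + 1 + 1) = 2 * n + 2 by ring, show n + 1 + (n + 1 + 1) = 2 * n + 3 by ring]
    ring
  rw [h3, h4] at h2
  rw [show 2 * (n + 1) = 2 * n + 2 by ring]
  have : g o = hitProb G d o n o + hitProb G d o (n + 1) o := rfl
  rw [← this]
  linarith

theorem summable_hitProb_pow_three [Infinite V] (hconn : G.Connected) (hd : 0 < d)
    (hreg : ∀ v, G.degree v = d) (o : V) :
    Summable fun n ↦ (hitProb G d o n o + hitProb G d o (n + 1) o) ^ 3 := by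
  have h0 := hitProb_nonneg (G := G) (d := d) o
  refine summable_of_sum_range_le (c := 32 * d * (hitProb G d o 0 o + hitProb G d o 1 o))
    (fun n ↦ pow_nonneg (add_nonneg (h0 _ _) (h0 _ _)) 3) fun N ↦ ?_
  refine (Finset.sum_le_sum fun n _ ↦ hitProb_pow_three_le hconn hd hreg o n).trans ?_
  rw [← Finset.mul_sum, Finset.sum_range_sub'
    (fun n ↦ hitProb G d o (2 * n) o + hitProb G d o (2 * n + 1) o)]
  refine mul_le_mul_of_nonneg_left ?_ (by positivity)
  linarith [h0 (2 * N) o, h0 (2 * N + 1) o]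

theorem summable_hitProb_div [Infinite V] (hconn : G.Connected) (hd : 0 < d)
    (hreg : ∀ v, G.degree v = d) (o : V) :
    Summable fun k : ℕ ↦ hitProb G d o (k + 1) o / (k + 1) := by
  have h0 := hitProb_nonneg (G := G) (d := d) o
  have hs1 := (summable_nat_add_iff 1).2 (summable_hitProb_pow_three hconn hd hreg o)
  have hs2 : Summable fun k : ℕ ↦ ((k + 1 : ℕ) : ℝ) ^ (-(3 / 2) : ℝ) :=
    (summable_nat_add_iff 1).2 (Real.summable_nat_rpow.2 (by norm_num))
  refine .of_nonneg_of_le (fun k ↦ div_nonneg (h0 _ _) (by positivity)) (fun k ↦ ?_) (hs1.add hs2)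
  set c : ℝ := ((k + 1 : ℕ) : ℝ) ^ (-(1 / 2) : ℝ) with hc
  have hk : (0 : ℝ) ≤ ((k + 1 : ℕ) : ℝ) := by positivity
  have hc0 : 0 ≤ c := by positivity
  have hc2 : c ^ 2 = ((k : ℝ) + 1)⁻¹ := by
    rw [hc, ← Real.rpow_natCast, ← Real.rpow_mul hk]
    norm_num [Real.rpow_neg_one]
  have hc3 : c ^ 3 = ((k + 1 : ℕ) : ℝ) ^ (-(3 / 2) : ℝ) := by
    rw [hc, ← Real.rpow_natCast, ← Real.rpow_mul hk]
    norm_num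
  rw [← hc3, div_eq_mul_inv, ← hc2]
  have ha := h0 (k + 1) o
  have hle : hitProb G d o (k + 1) o ≤ hitProb G d o (k + 1) o + hitProb G d o (k + 1 + 1) o :=
    le_add_of_nonneg_right (h0 _ _)
  refine le_trans ?_ (add_le_add_left (pow_le_pow_left₀ ha hle 3) (c ^ 3))
  generalize hitProb G d o (k + 1) o = a at ha
  rcases le_total a c with h | h
  · nlinarith [mul_le_mul_of_nonneg_right h (sq_nonneg c), pow_nonneg ha 3]
  · nlinarith [mul_le_mul_of_nonneg_left (pow_le_pow_left₀ hc0 h 2) ha, pow_nonneg hc0 3]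

end Summability

section Tree

open Filter Topology Finset

variable {d : ℝ}

theorem treeOp_mono (hd : 1 ≤ d) {f g : ℕ → ℝ} (h : ∀ n, f n ≤ g n) (n : ℕ) :
    treeOp d f n ≤ treeOp d g n := by
  cases n with
  | zero => exact mul_le_mul_of_nonneg_left (h 1) (by linarith)
  | succ n => exact add_le_add (h n) (mul_le_mul_of_nonneg_left (h _) (by linarith))

theorem treeOp_pow_mono (hd : 1 ≤ d) {f g : ℕ → ℝ} (h : ∀ n, f n ≤ g n) (k n : ℕ) :
    (treeOp d ^ k) f n ≤ (treeOp d ^ k) g n := by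
  induction k generalizing n with
  | zero => exact h n
  | succ k ih =>
    rw [pow_succ', Module.End.mul_apply, Module.End.mul_apply]
    exact treeOp_mono hd ih n

theorem treeOp_pow_nonneg (hd : 1 ≤ d) {f : ℕ → ℝ} (h : ∀ n, 0 ≤ f n) (k n : ℕ) :
    0 ≤ (treeOp d ^ k) f n := by
  simpa using treeOp_pow_mono hd (f := 0) h k n

theorem treeCount_nonneg (hd : 1 ≤ d) (k n : ℕ) : 0 ≤ treeCount d k n :=
  treeOp_pow_nonneg hd (fun n ↦ by rcases eq_or_ne n 0 with rfl | h <;> simp [*]) k n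

/-- Iterates of the tree operator on a bounded exponential grow at most like the spectral radius
`2 √(d - 1)`. -/
theorem treeOp_pow_geom_le (hd : 2 ≤ d) (k n : ℕ) :
    (treeOp d ^ k) (fun n ↦ (√(d - 1))⁻¹ ^ n) n ≤ (2 * √(d - 1)) ^ k * (√(d - 1))⁻¹ ^ n := by
  have hq : 1 ≤ √(d - 1) := Real.one_le_sqrt.2 (by linarith)
  have hq2 : √(d - 1) ^ 2 = d - 1 := Real.sq_sqrt (by linarith)
  set q := √(d - 1)
  have hq0 : q ≠ 0 := by positivity
  induction k generalizing n with
  | zero => simp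
  | succ k ih =>
    rw [pow_succ', Module.End.mul_apply]
    refine (treeOp_mono (by linarith) ih n).trans ?_
    have hpos : 0 < (2 * q) ^ k := by positivity
    cases n with
    | zero =>
      rw [treeOp_zero, pow_succ (2 * q) k, pow_one, pow_zero, mul_one, mul_left_comm]
      refine mul_le_mul_of_nonneg_left ?_ hpos.le
      rw [← div_eq_mul_inv, div_le_iff₀ (by positivity)]
      nlinarith
    | succ n =>
      refine le_of_eq ?_
      rw [treeOp_succ, ← hq2]
      simp only [pow_succ, inv_pow]
      field_simp
      ring

theorem treeCount_le (hd : 2 ≤ d) (k n : ℕ) : treeCount d k n ≤ (2 * √(d - 1)) ^ k := by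
  have hq : 1 ≤ √(d - 1) := Real.one_le_sqrt.2 (by linarith)
  refine (treeOp_pow_mono (by linarith) (g := fun n ↦ (√(d - 1))⁻¹ ^ n) (fun n ↦ ?_) k n).trans
    ((treeOp_pow_geom_le hd k n).trans ?_)
  · rcases eq_or_ne n 0 with rfl | h
    · simp
    · simp only [Pi.single_apply, if_neg h]
      positivity
  · exact mul_le_of_le_one_right (by positivity)
      (pow_le_one₀ (by positivity) (inv_le_one_of_one_le₀ hq))

/-- The substitution that rationalizes the Green function of the `d`-regular tree. -/
noncomputable def treeParam (d u : ℝ) : ℝ := u / (1 + (d - 1) * u ^ 2)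

theorem treeParam_lt (hd : 2 ≤ d) {u : ℝ} (hu : u < (√(d - 1))⁻¹) :
    treeParam d u < (2 * √(d - 1))⁻¹ := by
  have hq : 1 ≤ √(d - 1) := Real.one_le_sqrt.2 (by linarith)
  have hq2 : √(d - 1) ^ 2 = d - 1 := Real.sq_sqrt (by linarith)
  rw [treeParam]
  set q := √(d - 1)
  rw [← hq2]
  have hqu : q * u < 1 := by rwa [mul_comm, ← lt_div_iff₀ (by positivity), one_div]
  rw [div_lt_iff₀ (by positivity), ← div_eq_inv_mul, lt_div_iff₀ (by positivity)]
  nlinarith [sq_pos_of_pos (sub_pos.2 hqu)]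

theorem hasSum_treeCount (hd : 2 ≤ d) {u : ℝ} (hu0 : 0 ≤ u) (hu : u < (√(d - 1))⁻¹) (n : ℕ) :
    HasSum (fun k ↦ treeCount d k n * treeParam d u ^ k)
      ((1 + (d - 1) * u ^ 2) / (1 - u ^ 2) * u ^ n) := by
  have hq : 1 ≤ √(d - 1) := Real.one_le_sqrt.2 (by linarith)
  have hu1 : u < 1 := hu.trans_le (inv_le_one_of_one_le₀ hq)
  have hden : 0 < 1 + (d - 1) * u ^ 2 := by nlinarith [sq_nonneg u]
  have hden' : 0 < 1 - u ^ 2 := by nlinarith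
  have hx0 : 0 ≤ treeParam d u := div_nonneg hu0 hden.le
  set x := treeParam d u with hx
  set c := (1 + (d - 1) * u ^ 2) / (1 - u ^ 2) with hc
  have hc0 : 0 ≤ c := by positivity
  set φ : ℕ → ℝ := fun n ↦ c * u ^ n with hφ
  have hfix : φ = Pi.single 0 1 + x • treeOp d φ := by
    ext n
    cases n with
    | zero =>
      simp only [φ, c, hx, treeParam, Pi.add_apply, Pi.smul_apply, treeOp_zero, smul_eq_mul,
        Pi.single_eq_same]
      field_simp
      ring
    | succ n =>
      simp only [φ, c, hx, treeParam, Pi.add_apply, Pi.smul_apply, treeOp_succ, smul_eq_mul,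
        Pi.single_apply, Nat.succ_ne_zero, if_false]
      field_simp
      ring
  have hexp : ∀ K, φ n = ∑ k ∈ range K, treeCount d k n * x ^ k + (treeOp d ^ K) φ n * x ^ K := by
    intro K
    induction K with
    | zero => simp
    | succ K ih =>
      rw [ih, sum_range_succ]
      conv_lhs => rw [hfix]
      rw [map_add, map_smul, ← Module.End.mul_apply, ← pow_succ]
      simp only [Pi.add_apply, Pi.smul_apply, smul_eq_mul, treeCount]
      ring
  have hrem : Tendsto (fun K ↦ (treeOp d ^ K) φ n * x ^ K) atTop (𝓝 0) := by
    have hlt : x * (2 * √(d - 1)) < 1 := by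
      rw [← lt_div_iff₀ (by positivity), one_div]
      exact treeParam_lt hd hu
    have ht := (tendsto_pow_atTop_nhds_zero_of_lt_one (by positivity) hlt).const_mul c
    rw [mul_zero] at ht
    refine squeeze_zero (fun K ↦ mul_nonneg (treeOp_pow_nonneg (by linarith) (fun n ↦ by positivity)
      K n) (by positivity)) (fun K ↦ ?_) ht
    have hb : (treeOp d ^ K) φ n ≤ c * (2 * √(d - 1)) ^ K := by
      calc (treeOp d ^ K) φ n ≤ (treeOp d ^ K) (c • fun n ↦ (√(d - 1))⁻¹ ^ n) n :=
            treeOp_pow_mono (by linarith) (fun n ↦ mul_le_mul_of_nonneg_left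
              (pow_le_pow_left₀ hu0 hu.le n) hc0) K n
        _ = c * (treeOp d ^ K) (fun n ↦ (√(d - 1))⁻¹ ^ n) n := by
            rw [map_smul, Pi.smul_apply, smul_eq_mul]
        _ ≤ c * (2 * √(d - 1)) ^ K := by
            refine mul_le_mul_of_nonneg_left ((treeOp_pow_geom_le hd K n).trans ?_) hc0
            exact mul_le_of_le_one_right (by positivity)
              (pow_le_one₀ (by positivity) (inv_le_one_of_one_le₀ hq))
    calc _ ≤ c * (2 * √(d - 1)) ^ K * x ^ K := mul_le_mul_of_nonneg_right hb (by positivity)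
      _ = _ := by rw [mul_pow]; ring
  rw [hasSum_iff_tendsto_nat_of_nonneg
    fun k ↦ mul_nonneg (treeCount_nonneg (by linarith) k n) (by positivity)]
  have := hrem.const_sub (φ n)
  rw [sub_zero] at this
  refine this.congr fun K ↦ ?_
  rw [hexp K]
  ring

/-- The generating function `∑ treeCount d k 0 * y ^ k / k` over positive `k`. -/
noncomputable def treeLogSeries (d y : ℝ) : ℝ :=
  ∑' k : ℕ, treeCount d (k + 1) 0 / (k + 1) * y ^ (k + 1)

theorem summable_treeCount (hd : 2 ≤ d) {y : ℝ} (hy0 : 0 ≤ y) (hy : y < (2 * √(d - 1))⁻¹) (n : ℕ) :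
    Summable fun k : ℕ ↦ treeCount d k n * y ^ k := by
  have hq : 1 ≤ √(d - 1) := Real.one_le_sqrt.2 (by linarith)
  have hlt : 2 * √(d - 1) * y < 1 := by
    rwa [mul_comm, ← lt_div_iff₀ (by positivity), one_div]
  refine .of_nonneg_of_le (fun k ↦ mul_nonneg (treeCount_nonneg (by linarith) k n) (by positivity))
    (fun k ↦ ?_) (summable_geometric_of_lt_one (by positivity) hlt)
  rw [mul_pow]
  exact mul_le_mul_of_nonneg_right (treeCount_le hd k n) (by positivity)

theorem summable_treeCount_div (hd : 2 ≤ d) {y : ℝ} (hy0 : 0 ≤ y) (hy : y < (2 * √(d - 1))⁻¹) :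
    Summable fun k : ℕ ↦ treeCount d (k + 1) 0 / (k + 1) * y ^ (k + 1) := by
  have h0 : ∀ k, 0 ≤ treeCount d k 0 := fun k ↦ treeCount_nonneg (by linarith) k 0
  refine .of_nonneg_of_le (fun k ↦ mul_nonneg (div_nonneg (h0 _) (by positivity)) (by positivity))
    (fun k ↦ ?_) ((summable_nat_add_iff 1).2 (summable_treeCount hd hy0 hy 0))
  refine mul_le_mul_of_nonneg_right (div_le_self (h0 _) ?_) (by positivity)
  have := k.cast_nonneg (α := ℝ)
  linarith

theorem hasDerivAt_treeLogSeries (hd : 2 ≤ d) {y : ℝ} (hy0 : 0 ≤ y) (hy : y < (2 * √(d - 1))⁻¹) :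
    HasDerivAt (treeLogSeries d) (∑' k : ℕ, treeCount d (k + 1) 0 * y ^ k) y := by
  obtain ⟨r, hyr, hr⟩ := exists_between hy
  have hr0 : 0 < r := hy0.trans_lt hyr
  have hu : Summable fun k : ℕ ↦ treeCount d (k + 1) 0 * r ^ k := by
    have := ((summable_nat_add_iff 1).2 (summable_treeCount hd hr0.le hr 0)).mul_right r⁻¹
    refine this.congr fun k ↦ ?_
    rw [pow_succ]
    field_simp
  unfold treeLogSeries
  refine hasDerivAt_tsum_of_isPreconnected
    (g := fun k z ↦ treeCount d (k + 1) 0 / (k + 1) * z ^ (k + 1))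
    (g' := fun k z ↦ treeCount d (k + 1) 0 * z ^ k) hu (t := Set.Ioo (-r) r) isOpen_Ioo isPreconnected_Ioo
    (fun k z _ ↦ ?_) (fun k z hz ↦ ?_) (y₀ := y) ⟨by linarith, hyr⟩
    (summable_treeCount_div hd hy0 hy) ⟨by linarith, hyr⟩
  · have := (hasDerivAt_pow (k + 1) z).const_mul (treeCount d (k + 1) 0 / (k + 1))
    refine this.congr_deriv ?_
    push_cast
    field_simp
  · rw [norm_mul, norm_pow, Real.norm_of_nonneg (treeCount_nonneg (by linarith) _ _)]
    refine mul_le_mul_of_nonneg_left (pow_le_pow_left₀ (norm_nonneg _) ?_ k)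
      (treeCount_nonneg (by linarith) _ _)
    rw [Real.norm_eq_abs, abs_le]
    exact ⟨hz.1.le, hz.2.le⟩

theorem tsum_treeCount_succ (hd : 2 ≤ d) {u : ℝ} (hu0 : 0 ≤ u) (hu : u < (√(d - 1))⁻¹) :
    ∑' k : ℕ, treeCount d (k + 1) 0 * treeParam d u ^ k =
      d * ((1 + (d - 1) * u ^ 2) / (1 - u ^ 2) * u) := by
  have := (hasSum_treeCount hd hu0 hu 1).mul_left d
  rw [pow_one] at this
  rw [← this.tsum_eq]
  refine tsum_congr fun k ↦ ?_
  rw [treeCount_succ, treeOp_zero, mul_assoc]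

theorem treeLogSeries_treeParam (hd : 2 ≤ d) {u : ℝ} (hu0 : 0 ≤ u) (hu : u < (√(d - 1))⁻¹) :
    treeLogSeries d (treeParam d u) =
      (d / 2 - 1) * Real.log (1 - u ^ 2) + Real.log (1 + (d - 1) * u ^ 2) := by
  have hq : 1 ≤ √(d - 1) := Real.one_le_sqrt.2 (by linarith)
  set F : ℝ → ℝ := fun u ↦ treeLogSeries d (treeParam d u) -
    ((d / 2 - 1) * Real.log (1 - u ^ 2) + Real.log (1 + (d - 1) * u ^ 2)) with hF
  have hder : ∀ t ∈ Set.Icc 0 u, HasDerivAt F 0 t := by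
    intro t ht
    have htq : t < (√(d - 1))⁻¹ := ht.2.trans_lt hu
    have ht1 : t < 1 := htq.trans_le (inv_le_one_of_one_le₀ hq)
    have hden : 0 < 1 + (d - 1) * t ^ 2 := by nlinarith [sq_nonneg t]
    have hden' : 0 < 1 - t ^ 2 := by nlinarith [ht.1]
    have hsq : HasDerivAt (fun t : ℝ ↦ t ^ 2) (2 * t) t := by simpa using hasDerivAt_pow 2 t
    have h1 : HasDerivAt (fun t : ℝ ↦ 1 + (d - 1) * t ^ 2) ((d - 1) * (2 * t)) t :=
      (hsq.const_mul (d - 1)).const_add 1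
    have h2 : HasDerivAt (fun t : ℝ ↦ 1 - t ^ 2) (-(2 * t)) t := hsq.const_sub 1
    have h3 : HasDerivAt (treeParam d) _ t := (hasDerivAt_id t).div h1 hden.ne'
    have h4 := (hasDerivAt_treeLogSeries hd (div_nonneg ht.1 hden.le) (treeParam_lt hd htq)).comp
      t h3
    have h5 := h4.sub (((h2.log hden'.ne').const_mul (d / 2 - 1)).add (h1.log hden.ne'))
    refine HasDerivAt.congr_deriv h5 ?_
    rw [← treeParam, tsum_treeCount_succ hd ht.1 htq]
    simp only [id]
    field_simp
    ring
  have hconst := constant_of_has_deriv_right_zero (f := F) (a := 0) (b := u)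
    (fun t ht ↦ (hder t ht).continuousAt.continuousWithinAt)
    (fun t ht ↦ (hder t ⟨ht.1, ht.2.le⟩).hasDerivWithinAt) u ⟨hu0, le_rfl⟩
  have hF0 : F 0 = 0 := by simp [F, treeParam, treeLogSeries]
  rw [hF0] at hconst
  exact sub_eq_zero.1 hconst

end Tree

theorem log_sub_treeLogSeries {d : ℕ} (hd : 3 ≤ d) :
    Real.log d - treeLogSeries d (d : ℝ)⁻¹ =
      Real.log (((d : ℝ) - 1) ^ (d - 1) / (((d : ℝ) * ((d : ℝ) - 2)) ^ ((d : ℝ) / 2 - 1))) := by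
  have hd' : (3 : ℝ) ≤ d := by exact_mod_cast hd
  have hpow : (((d : ℝ) - 1) ^ (d - 1)) = ((d : ℝ) - 1) ^ ((d : ℝ) - 1) := by
    rw [← Real.rpow_natCast, Nat.cast_sub (by omega), Nat.cast_one]
  rw [hpow]
  generalize (d : ℝ) = x at hd'
  have hx1 : 0 < x - 1 := by linarith
  have hx2 : 0 < x - 2 := by linarith
  have hparam : treeParam x (x - 1)⁻¹ = x⁻¹ := by
    rw [treeParam]
    field_simp
    ring
  have hlt : (x - 1)⁻¹ < (√(x - 1))⁻¹ := by
    refine inv_strictAnti₀ (by positivity) ?_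
    rw [Real.sqrt_lt' hx1]
    nlinarith
  rw [← hparam, treeLogSeries_treeParam (by linarith) (by positivity) hlt,
    show 1 - (x - 1)⁻¹ ^ 2 = x * (x - 2) / (x - 1) ^ 2 by field_simp; ring,
    show 1 + (x - 1) * (x - 1)⁻¹ ^ 2 = x / (x - 1) by field_simp; ring,
    Real.log_div (by positivity) (by positivity), Real.log_div (by positivity) (by positivity),
    Real.log_div (by positivity) (by positivity), Real.log_rpow hx1,
    Real.log_rpow (by positivity), Real.log_pow]
  push_cast
  ring

theorem summable_treeCount_div_pow {d : ℕ} (hd : 3 ≤ d) :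
    Summable fun k : ℕ ↦ treeCount d (k + 1) 0 / (k + 1) * (d : ℝ)⁻¹ ^ (k + 1) := by
  have hd' : (3 : ℝ) ≤ d := by exact_mod_cast hd
  refine summable_treeCount_div (by linarith) (by positivity) (inv_strictAnti₀ ?_ ?_)
  · have : 0 < √((d : ℝ) - 1) := Real.sqrt_pos.2 (by linarith)
    positivity
  · rw [← lt_div_iff₀' two_pos, Real.sqrt_lt' (by positivity)]
    nlinarith

/-- Proposition: among all infinite connected transitive graphs `G` of degree `d ≥ 3`, the
tree entropy is maximized uniquely by the `d`-regular tree, with maximum value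
`log((d-1)^{d-1}/(d(d-2))^{d/2-1})`; uniqueness is expressed by: equality holds iff `G` is
acyclic (i.e., `G` is the `d`-regular tree). -/
theorem stmt15 {V : Type*} [Infinite V] (G : SimpleGraph V)
    [∀ v, Fintype (G.neighborSet v)]
    (hconn : G.Connected)
    (htr : ∀ u v : V, ∃ e : G ≃g G, e u = v)
    (d : ℕ) (hd : 3 ≤ d) (hreg : ∀ v, G.degree v = d) (o : V) :
    treeEntropy G d o ≤
        Real.log (((d : ℝ) - 1) ^ (d - 1) / (((d : ℝ) * ((d : ℝ) - 2)) ^ ((d : ℝ) / 2 - 1))) ∧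
      (treeEntropy G d o =
          Real.log (((d : ℝ) - 1) ^ (d - 1) / (((d : ℝ) * ((d : ℝ) - 2)) ^ ((d : ℝ) / 2 - 1)))
        ↔ G.IsAcyclic) := by
  have hd0 : (0 : ℝ) < d := by exact_mod_cast (by omega : 0 < d)
  have hs := summable_treeCount_div_pow hd
  have hsG := summable_hitProb_div hconn (by omega) hreg o
  have hterm : ∀ k : ℕ, hitProb G d o (k + 1) o / (k + 1) =
      walkCount G o (k + 1) o / (k + 1) * (d : ℝ)⁻¹ ^ (k + 1) := fun k ↦ by
    rw [hitProb, inv_pow]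
    ring
  have hle : ∀ k : ℕ, treeCount d (k + 1) 0 / (k + 1) * (d : ℝ)⁻¹ ^ (k + 1) ≤
      hitProb G d o (k + 1) o / (k + 1) := fun k ↦ by
    rw [hterm]
    have := (treeCount_le_walkCount (o := o) hreg (k + 1)).1
    gcongr
  have hent : treeEntropy G d o =
      Real.log d - ∑' k : ℕ, hitProb G d o (k + 1) o / (k + 1) := rfl
  rw [← log_sub_treeLogSeries hd, hent, sub_right_inj, isAcyclic_iff_walkCount_eq htr hreg o,
    treeLogSeries]
  refine ⟨sub_le_sub_left (hs.tsum_le_tsum hle hsG) _, fun heq k ↦ ?_, fun heq ↦ ?_⟩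
  · cases k with
    | zero => rw [walkCount_zero_self, treeCount_zero_zero]
    | succ k =>
      by_contra hne
      refine (Summable.tsum_lt_tsum hle (i := k) ((hle k).lt_of_ne fun h ↦ hne ?_) hs hsG).ne' heq
      rw [hterm] at h
      have hk : (k : ℝ) + 1 ≠ 0 := by positivity
      exact ((div_left_inj' hk).1 (mul_right_cancel₀ (by positivity) h)).symm
  · exact tsum_congr fun k ↦ by rw [hterm, heq]
end
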